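/- arXiv:1803.01239 — 5 statements merged into one kernel-verified Lean document; each statement's English description precedes it below -/
import Mathlib

section
/- For every finite simple graph G on vertex set [n] and every field K, the binomial edge ideal J_G admits the primary decomposition J_G = ⋂_{T ∈ C(G)} P_T(G), the intersection being taken over all cutsets T of G. -/
/-!
Common definitions: binomial edge ideals, cutsets, the prime ideals `P_T(G)`,
block graphs, clique degrees, endblocks, decomposability, and their relative
versions for induced subgraphs (an induced subgraph of `G` is recorded by its
vertex set `W`).
-/

noncomputable section
open MvPolynomial

/-- The edge binomial `f_{ij} = x_i y_j - x_j y_i` in `K[x_v, y_v : v ∈ V]`,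
encoded as `MvPolynomial (V ⊕ V) K` with `Sum.inl i ↦ x_i`, `Sum.inr i ↦ y_i`. -/
def ebin (K : Type*) [Field K] {V : Type*} (i j : V) : MvPolynomial (V ⊕ V) K :=
  X (Sum.inl i) * X (Sum.inr j) - X (Sum.inl j) * X (Sum.inr i)

/-- The binomial edge ideal `J_G`, generated by the `f_{ij}` over the edges of `G`. -/
def binomialEdgeIdeal (K : Type*) [Field K] {V : Type*} (G : SimpleGraph V) :
    Ideal (MvPolynomial (V ⊕ V) K) :=
  Ideal.span {p | ∃ i j, G.Adj i j ∧ p = ebin K i j}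

/-- The binomial edge ideal of the induced subgraph of `G` on `W`, regarded as an
ideal of the full polynomial ring on all of `V`. -/
def binomialEdgeIdealOn (K : Type*) [Field K] {V : Type*} (G : SimpleGraph V)
    (W : Set V) : Ideal (MvPolynomial (V ⊕ V) K) :=
  Ideal.span {p | ∃ i ∈ W, ∃ j ∈ W, G.Adj i j ∧ p = ebin K i j}

/-- `c(T)`: the number of connected components of the induced subgraph on `Tᶜ`. -/
def numComp {V : Type*} (G : SimpleGraph V) (T : Set V) : ℕ :=
  Nat.card (G.induce Tᶜ).ConnectedComponent

/-- `T` is a cutset of `G` if `c(T ∖ {i}) < c(T)` for every `i ∈ T`. -/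
def IsCutset {V : Type*} (G : SimpleGraph V) (T : Set V) : Prop :=
  ∀ i ∈ T, numComp G (T \ {i}) < numComp G T

/-- The prime ideal `P_T(G)`, generated by the variables `x_i, y_i` for `i ∈ T`
together with all binomials `f_{ij}` with `i ≠ j` in one connected component of
the induced subgraph on `Tᶜ`. -/
def cutIdeal (K : Type*) [Field K] {V : Type*} (G : SimpleGraph V) (T : Set V) :
    Ideal (MvPolynomial (V ⊕ V) K) :=
  Ideal.span ({p | ∃ i ∈ T, p = X (Sum.inl i) ∨ p = X (Sum.inr i)} ∪
    {p | ∃ i j, ∃ (hi : i ∈ Tᶜ) (hj : j ∈ Tᶜ), i ≠ j ∧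
      (G.induce Tᶜ).Reachable ⟨i, hi⟩ ⟨j, hj⟩ ∧ p = ebin K i j})

/-- A graph is a block graph iff all its blocks are complete; equivalently,
the vertices of every cycle form a clique. -/
def IsBlockGraph {V : Type*} (G : SimpleGraph V) : Prop :=
  ∀ (v : V) (c : G.Walk v v), c.IsCycle →
    ∀ x ∈ c.support, ∀ y ∈ c.support, x ≠ y → G.Adj x y

/-- The clique degree of `v`: the number of maximal cliques of `G` containing `v`. -/
def cliqueDeg {V : Type*} (G : SimpleGraph V) (v : V) : ℕ :=
  {s : Set V | Maximal G.IsClique s ∧ v ∈ s}.ncard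

/-- `v` is a cutpoint of `G`: removing it increases the number of connected components. -/
def IsCutpoint {V : Type*} (G : SimpleGraph V) (v : V) : Prop :=
  Nat.card G.ConnectedComponent < Nat.card (G.induce {v}ᶜ).ConnectedComponent

/-- An endblock of a block graph: a maximal clique with at least two vertices
containing exactly one cutpoint. -/
def IsEndblock {V : Type*} (G : SimpleGraph V) (B : Set V) : Prop :=
  Maximal G.IsClique B ∧ 2 ≤ B.ncard ∧ ∃! w, w ∈ B ∧ IsCutpoint G w

/-- `P_T(G) ∈ Minh(G)`: `T` is a cutset whose prime `P_T(G)` has minimum height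
among all `P_{T'}(G)` with `T'` a cutset; since `height P_T(G) = n - c(T) + |T|`,
this says `c(T') + |T| ≤ c(T) + |T'|` for all cutsets `T'`. -/
def InMinh {V : Type*} (G : SimpleGraph V) (T : Set V) : Prop :=
  IsCutset G T ∧ ∀ T', IsCutset G T' →
    numComp G T' + T.ncard ≤ numComp G T + T'.ncard

/-! Relative versions: the graph under consideration is the induced subgraph of
`G` on the vertex set `W`. -/

/-- Number of connected components of the induced subgraph on `W` after removing `T`. -/
def numCompOn {V : Type*} (G : SimpleGraph V) (W T : Set V) : ℕ :=
  Nat.card (G.induce (W \ T)).ConnectedComponent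

/-- `T` is a cutset of the induced subgraph of `G` on `W`. -/
def IsCutsetOn {V : Type*} (G : SimpleGraph V) (W T : Set V) : Prop :=
  T ⊆ W ∧ ∀ i ∈ T, numCompOn G W (T \ {i}) < numCompOn G W T

/-- `P_T ∈ Minh` for the induced subgraph of `G` on `W`. -/
def InMinhOn {V : Type*} (G : SimpleGraph V) (W T : Set V) : Prop :=
  IsCutsetOn G W T ∧ ∀ T', IsCutsetOn G W T' →
    numCompOn G W T' + T.ncard ≤ numCompOn G W T + T'.ncard

/-- `B` is a maximal clique of the induced subgraph of `G` on `W`. -/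
def IsMaxCliqueOn {V : Type*} (G : SimpleGraph V) (W B : Set V) : Prop :=
  Maximal (fun s => s ⊆ W ∧ G.IsClique s) B

/-- Clique degree of `v` in the induced subgraph of `G` on `W`. -/
def cliqueDegOn {V : Type*} (G : SimpleGraph V) (W : Set V) (v : V) : ℕ :=
  {B : Set V | IsMaxCliqueOn G W B ∧ v ∈ B}.ncard

/-- `w` is a cutpoint of the induced subgraph of `G` on `W`. -/
def IsCutpointOn {V : Type*} (G : SimpleGraph V) (W : Set V) (w : V) : Prop :=
  w ∈ W ∧ Nat.card (G.induce W).ConnectedComponent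
    < Nat.card (G.induce (W \ {w})).ConnectedComponent

/-- `B` is an endblock of the induced subgraph of `G` on `W`. -/
def IsEndblockOn {V : Type*} (G : SimpleGraph V) (W B : Set V) : Prop :=
  IsMaxCliqueOn G W B ∧ 2 ≤ B.ncard ∧ ∃! w, w ∈ B ∧ IsCutpointOn G W w

/-- The induced subgraph of `G` on `W` is decomposable: it is the union of two
subgraphs, each containing an edge, whose vertex sets `W₁, W₂` intersect in a
single vertex that is a free vertex of both. -/
def DecomposableOn {V : Type*} (G : SimpleGraph V) (W : Set V) : Prop :=
  ∃ W₁ W₂ : Set V, ∃ v : V, W₁ ∪ W₂ = W ∧ W₁ ∩ W₂ = {v} ∧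
    (∃ a ∈ W₁, ∃ b ∈ W₁, G.Adj a b) ∧ (∃ a ∈ W₂, ∃ b ∈ W₂, G.Adj a b) ∧
    (∀ a b, a ∈ W → b ∈ W → G.Adj a b → (a ∈ W₁ ∧ b ∈ W₁) ∨ (a ∈ W₂ ∧ b ∈ W₂)) ∧
    cliqueDegOn G W₁ v = 1 ∧ cliqueDegOn G W₂ v = 1

/-- `𝒟` is the decomposition of the induced subgraph of `G` on `W` into
indecomposable components: the members cover `W` and all its edges, each member
is indecomposable (an isolated vertex or a graph with an edge), and two distinct
members meet in at most one vertex, which is free in both. -/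
def IsDecompositionOn {V : Type*} (G : SimpleGraph V) (W : Set V)
    (𝒟 : Finset (Set V)) : Prop :=
  (∀ U ∈ 𝒟, U ⊆ W) ∧ ⋃₀ ↑𝒟 = W ∧
  (∀ a b, a ∈ W → b ∈ W → G.Adj a b → ∃ U ∈ 𝒟, a ∈ U ∧ b ∈ U) ∧
  (∀ U ∈ 𝒟, (∃ a ∈ U, ∃ b ∈ U, G.Adj a b) ∨ (∃ w, U = {w} ∧ ∀ u ∈ W, ¬ G.Adj w u)) ∧
  (∀ U₁ ∈ 𝒟, ∀ U₂ ∈ 𝒟, U₁ ≠ U₂ →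
    U₁ ∩ U₂ = ∅ ∨ ∃ w, U₁ ∩ U₂ = {w} ∧ cliqueDegOn G U₁ w = 1 ∧ cliqueDegOn G U₂ w = 1) ∧
  (∀ U ∈ 𝒟, ¬ DecomposableOn G U)

/-- `i(G)`: the number of inner vertices (vertices of clique degree `> 1`) of the
induced subgraph of `G` on `W`. -/
def innerCountOn {V : Type*} (G : SimpleGraph V) (W : Set V) : ℕ :=
  {v | v ∈ W ∧ 1 < cliqueDegOn G W v}.ncard

/-- The ideal generated by the variables `x_i, y_i` with `i ∈ T`. -/
def varIdeal (K : Type*) [Field K] {V : Type*} (T : Set V) : Ideal (MvPolynomial (V ⊕ V) K) :=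
  Ideal.span {p | ∃ i ∈ T, p = X (Sum.inl i) ∨ p = X (Sum.inr i)}

/-- The substitution `x_v = y_v = 0`. -/
def killVertex (K : Type*) [Field K] {V : Type*} (v : V) :
    MvPolynomial (V ⊕ V) K →ₐ[K] MvPolynomial (V ⊕ V) K :=
  open Classical in aeval fun w => if w = Sum.inl v ∨ w = Sum.inr v then 0 else X w

section BinomialEdgeIdeal

variable {K : Type*} [Field K] {V : Type*} {G G' : SimpleGraph V} {S T : Set V} {i j v : V}

theorem X_inl_mem_varIdeal (hi : i ∈ T) :
    (X (Sum.inl i) : MvPolynomial (V ⊕ V) K) ∈ varIdeal K T :=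
  Ideal.subset_span ⟨i, hi, Or.inl rfl⟩

theorem X_inr_mem_varIdeal (hi : i ∈ T) :
    (X (Sum.inr i) : MvPolynomial (V ⊕ V) K) ∈ varIdeal K T :=
  Ideal.subset_span ⟨i, hi, Or.inr rfl⟩

theorem varIdeal_mono (h : S ⊆ T) : varIdeal K S ≤ varIdeal K T :=
  Ideal.span_mono fun _ ⟨i, hi, hp⟩ => ⟨i, h hi, hp⟩

theorem varIdeal_le_cutIdeal : varIdeal K T ≤ cutIdeal K G T :=
  Ideal.span_mono Set.subset_union_left

theorem ebin_mem_varIdeal (h : i ∈ T ∨ j ∈ T) : ebin K i j ∈ varIdeal K T := by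
  unfold ebin
  rcases h with h | h
  · exact sub_mem (Ideal.mul_mem_right _ _ (X_inl_mem_varIdeal h))
      (Ideal.mul_mem_left _ _ (X_inr_mem_varIdeal h))
  · exact sub_mem (Ideal.mul_mem_left _ _ (X_inr_mem_varIdeal h))
      (Ideal.mul_mem_right _ _ (X_inl_mem_varIdeal h))

theorem ebin_mem_binomialEdgeIdeal (h : G.Adj i j) : ebin K i j ∈ binomialEdgeIdeal K G :=
  Ideal.subset_span ⟨i, j, h, rfl⟩

theorem ebin_mem_cutIdeal (hi : i ∈ Tᶜ) (hj : j ∈ Tᶜ)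
    (h : (G.induce Tᶜ).Reachable ⟨i, hi⟩ ⟨j, hj⟩) : ebin K i j ∈ cutIdeal K G T := by
  by_cases hij : i = j
  · subst hij
    simp [ebin]
  · exact Ideal.subset_span (Or.inr ⟨i, j, hi, hj, hij, h, rfl⟩)

theorem binomialEdgeIdeal_le_cutIdeal : binomialEdgeIdeal K G ≤ cutIdeal K G T := by
  refine Ideal.span_le.2 ?_
  rintro _ ⟨i, j, h, rfl⟩
  by_cases hi : i ∈ T
  · exact varIdeal_le_cutIdeal (ebin_mem_varIdeal (Or.inl hi))
  by_cases hj : j ∈ T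
  · exact varIdeal_le_cutIdeal (ebin_mem_varIdeal (Or.inr hj))
  exact ebin_mem_cutIdeal hi hj (SimpleGraph.Adj.reachable (G := G.induce Tᶜ) h)

theorem cutIdeal_mono_left (h : G ≤ G') : cutIdeal K G T ≤ cutIdeal K G' T := by
  refine Ideal.span_mono (Set.union_subset_union_right _ ?_)
  rintro _ ⟨i, j, hi, hj, hij, hr, rfl⟩
  exact ⟨i, j, hi, hj, hij, hr.mono fun _ _ hab => h hab, rfl⟩

theorem cutIdeal_le_varIdeal_sup
    (h : ∀ v ∉ T, ∀ i ∉ T, ∀ j ∉ T, G.Adj v i → G.Adj v j → i ≠ j → G.Adj i j) :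
    cutIdeal K G T ≤ varIdeal K T ⊔ binomialEdgeIdeal K G := by
  refine Ideal.span_le.2 (Set.union_subset (fun p hp => ?_) ?_)
  · exact Ideal.mem_sup_left (Ideal.subset_span hp)
  rintro _ ⟨i, j, hi, hj, hij, hr, rfl⟩
  refine Ideal.mem_sup_right (ebin_mem_binomialEdgeIdeal ?_)
  have key : ∀ b : (Tᶜ : Set V), (G.induce Tᶜ).Reachable ⟨i, hi⟩ b → i = b ∨ G.Adj i b := by
    intro b hb
    rw [SimpleGraph.reachable_iff_reflTransGen] at hb
    induction hb with
    | refl => exact Or.inl rfl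
    | @tail b c _ hbc ih =>
      have hbc' : G.Adj b c := hbc
      rcases ih with ih | ih
      · exact Or.inr (ih ▸ hbc')
      · by_cases hic : i = c
        · exact Or.inl hic
        · exact Or.inr (h b b.2 i hi c c.2 ih.symm hbc' hic)
  exact (key _ hr).resolve_left hij

theorem mul_ebin_mem_binomialEdgeIdeal (hi : G.Adj v i) (hj : G.Adj v j)
    {p : MvPolynomial (V ⊕ V) K} (hp : p ∈ varIdeal K {v}) :
    p * ebin K i j ∈ binomialEdgeIdeal K G := by
  induction hp using Submodule.span_induction with
  | zero => simp
  | add p q _ _ hp hq => rw [add_mul]; exact add_mem hp hq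
  | smul r p _ hp => rw [smul_eq_mul, mul_assoc]; exact Ideal.mul_mem_left _ _ hp
  | mem p hp =>
    obtain ⟨w, rfl, rfl | rfl⟩ := hp
    · have : X (Sum.inl w) * ebin K i j =
          X (Sum.inl i) * ebin K w j - X (Sum.inl j) * ebin K w i := by
        unfold ebin; ring
      rw [this]
      exact sub_mem (Ideal.mul_mem_left _ _ (ebin_mem_binomialEdgeIdeal hj))
        (Ideal.mul_mem_left _ _ (ebin_mem_binomialEdgeIdeal hi))
    · have : X (Sum.inr w) * ebin K i j =
          X (Sum.inr i) * ebin K w j - X (Sum.inr j) * ebin K w i := by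
        unfold ebin; ring
      rw [this]
      exact sub_mem (Ideal.mul_mem_left _ _ (ebin_mem_binomialEdgeIdeal hj))
        (Ideal.mul_mem_left _ _ (ebin_mem_binomialEdgeIdeal hi))

theorem killVertex_X_inl_self : killVertex K v (X (Sum.inl v)) = 0 := by simp [killVertex]

theorem killVertex_X_inr_self : killVertex K v (X (Sum.inr v)) = 0 := by simp [killVertex]

theorem killVertex_X_inl (h : i ≠ v) : killVertex K v (X (Sum.inl i)) = X (Sum.inl i) := by
  simp [killVertex, h]

theorem killVertex_X_inr (h : i ≠ v) : killVertex K v (X (Sum.inr i)) = X (Sum.inr i) := by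
  simp [killVertex, h]

theorem killVertex_ebin (hi : i ≠ v) (hj : j ≠ v) : killVertex K v (ebin K i j) = ebin K i j := by
  simp [ebin, killVertex_X_inl, killVertex_X_inr, hi, hj]

theorem killVertex_ebin_eq_zero (h : i = v ∨ j = v) : killVertex K v (ebin K i j) = 0 := by
  rcases h with rfl | rfl <;> simp [ebin, killVertex_X_inl_self, killVertex_X_inr_self]

theorem sub_killVertex_mem (v : V) (p : MvPolynomial (V ⊕ V) K) :
    p - killVertex K v p ∈ varIdeal K {v} := by
  induction p using MvPolynomial.induction_on with
  | C a => simp [killVertex]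
  | add p q hp hq => rw [map_add, add_sub_add_comm]; exact add_mem hp hq
  | mul_X p w hp =>
    have hw : X w - killVertex K v (X w) ∈ varIdeal K {v} := by
      rcases w with w | w <;> by_cases h : w = v
      · subst h; simpa [killVertex_X_inl_self] using X_inl_mem_varIdeal (Set.mem_singleton w)
      · simp [killVertex_X_inl h]
      · subst h; simpa [killVertex_X_inr_self] using X_inr_mem_varIdeal (Set.mem_singleton w)
      · simp [killVertex_X_inr h]
    rw [map_mul, show p * X w - killVertex K v p * killVertex K v (X w) =
      (p - killVertex K v p) * X w + killVertex K v p * (X w - killVertex K v (X w)) by ring]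
    exact add_mem (Ideal.mul_mem_right _ _ hp) (Ideal.mul_mem_left _ _ hw)

theorem killVertex_mem {p : MvPolynomial (V ⊕ V) K}
    (hp : p ∈ varIdeal K (insert v T) ⊔ binomialEdgeIdeal K G) :
    killVertex K v p ∈ varIdeal K T ⊔ binomialEdgeIdeal K G := by
  suffices h : varIdeal K (insert v T) ⊔ binomialEdgeIdeal K G ≤
      (varIdeal K T ⊔ binomialEdgeIdeal K G).comap (killVertex K v) from h hp
  refine sup_le (Ideal.span_le.2 ?_) (Ideal.span_le.2 ?_)
  · rintro _ ⟨i, hi, hq⟩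
    by_cases hiv : i = v
    · subst hiv
      rcases hq with rfl | rfl <;> simp [killVertex_X_inl_self, killVertex_X_inr_self]
    · have hiT : i ∈ T := hi.resolve_left hiv
      rcases hq with rfl | rfl
      · simpa [killVertex_X_inl hiv] using Ideal.mem_sup_left (X_inl_mem_varIdeal hiT)
      · simpa [killVertex_X_inr hiv] using Ideal.mem_sup_left (X_inr_mem_varIdeal hiT)
  · rintro _ ⟨i, j, hij, rfl⟩
    by_cases h : i = v ∨ j = v
    · simp [killVertex_ebin_eq_zero h]
    · rw [not_or] at h
      simpa [killVertex_ebin h.1 h.2] using Ideal.mem_sup_right (ebin_mem_binomialEdgeIdeal hij)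

theorem binomialEdgeIdeal_sup_edge_le (i j : V) :
    binomialEdgeIdeal K (G ⊔ SimpleGraph.edge i j) ≤
      binomialEdgeIdeal K G ⊔ Ideal.span {ebin K i j} := by
  refine Ideal.span_le.2 ?_
  rintro _ ⟨a, b, hab, rfl⟩
  rcases hab with hab | hab
  · exact Ideal.mem_sup_left (ebin_mem_binomialEdgeIdeal hab)
  · refine Ideal.mem_sup_right ?_
    rw [SimpleGraph.edge_adj] at hab
    obtain ⟨⟨rfl, rfl⟩ | ⟨rfl, rfl⟩, -⟩ := hab
    · exact Ideal.mem_span_singleton_self _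
    · rw [show ebin K a b = -ebin K b a by unfold ebin; ring]
      exact neg_mem (Ideal.mem_span_singleton_self _)

/-- Adding an edge between two neighbours of `v`, or killing `v`, splits `J_G`. -/
theorem inf_le_varIdeal_sup_binomialEdgeIdeal (hi : G.Adj v i) (hj : G.Adj v j) :
    (varIdeal K T ⊔ binomialEdgeIdeal K (G ⊔ SimpleGraph.edge i j)) ⊓
      (varIdeal K (insert v T) ⊔ binomialEdgeIdeal K G) ≤
      varIdeal K T ⊔ binomialEdgeIdeal K G := by
  rintro h ⟨h₁, h₂⟩
  replace h₁ := sup_le_sup_left (binomialEdgeIdeal_sup_edge_le i j) _ h₁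
  rw [← sup_assoc] at h₁
  obtain ⟨a, ha, b, hb, rfl⟩ := Submodule.mem_sup.1 h₁
  obtain ⟨g, rfl⟩ := Ideal.mem_span_singleton'.1 hb
  refine add_mem ha ?_
  have hle : varIdeal K T ⊔ binomialEdgeIdeal K G ≤
      varIdeal K (insert v T) ⊔ binomialEdgeIdeal K G :=
    sup_le_sup_right (varIdeal_mono (Set.subset_insert v T)) _
  have h₃ := killVertex_mem ((Ideal.add_mem_iff_right _ (hle ha)).1 h₂)
  rw [map_mul, killVertex_ebin hi.ne' hj.ne'] at h₃
  have h₄ := mul_ebin_mem_binomialEdgeIdeal hi hj (sub_killVertex_mem v g)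
  rw [show g * ebin K i j =
    killVertex K v g * ebin K i j + (g - killVertex K v g) * ebin K i j by ring]
  exact add_mem h₃ (Ideal.mem_sup_right h₄)

theorem iInf_cutIdeal_le_varIdeal_sup [Finite V] (T : Set V) (G : SimpleGraph V) :
    ⨅ S ∈ {S : Set V | T ⊆ S}, cutIdeal K G S ≤ varIdeal K T ⊔ binomialEdgeIdeal K G := by
  suffices h : ∀ x : Set V × SimpleGraph V, ⨅ S ∈ {S : Set V | x.1 ⊆ S}, cutIdeal K x.2 S ≤
      varIdeal K x.1 ⊔ binomialEdgeIdeal K x.2 from h (T, G)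
  clear T G
  intro x
  induction x using WellFoundedGT.induction with
  | ind x ih =>
  obtain ⟨T, G⟩ := x
  dsimp only at ih ⊢
  by_cases h : ∀ v ∉ T, ∀ i ∉ T, ∀ j ∉ T, G.Adj v i → G.Adj v j → i ≠ j → G.Adj i j
  · exact (iInf₂_le T (Set.Subset.refl T)).trans (cutIdeal_le_varIdeal_sup h)
  push Not at h
  obtain ⟨v, hv, i, -, j, -, hi, hj, hij, hnij⟩ := h
  refine le_trans (le_inf ?_ ?_) (inf_le_varIdeal_sup_binomialEdgeIdeal hi hj)
  · have hlt : G < G ⊔ SimpleGraph.edge i j := by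
      refine lt_of_le_of_ne le_sup_left fun he => hnij ?_
      rw [he]
      exact Or.inr ((SimpleGraph.edge_adj ..).2 ⟨Or.inl ⟨rfl, rfl⟩, hij⟩)
    refine le_trans ?_ (ih (T, G ⊔ SimpleGraph.edge i j) (Prod.mk_lt_mk_iff_right.2 hlt))
    exact iInf₂_mono fun S _ => cutIdeal_mono_left hlt.le
  · refine le_trans ?_ (ih (insert v T, G) (Prod.mk_lt_mk_iff_left.2 (Set.ssubset_insert hv)))
    exact biInf_mono fun S hS => (Set.subset_insert v T).trans hS

/-- Restoring a removed vertex `i` that does not lower the number of components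
joins no two of them. -/
theorem reachable_of_numComp_le [Finite V]
    (hle : numComp G S ≤ numComp G (S \ {i})) {a b : V} (ha : a ∈ Sᶜ) (hb : b ∈ Sᶜ)
    (hr : (G.induce (S \ {i})ᶜ).Reachable ⟨a, fun h => ha h.1⟩ ⟨b, fun h => hb h.1⟩) :
    (G.induce Sᶜ).Reachable ⟨a, ha⟩ ⟨b, hb⟩ := by
  have hsub : Sᶜ ⊆ (S \ {i})ᶜ := Set.compl_subset_compl.2 Set.sdiff_subset
  have hmem : ∀ c : ((S \ {i})ᶜ : Set V), (c : V) ≠ i → (c : V) ∈ Sᶜ :=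
    fun c hc hcS => c.2 ⟨hcS, hc⟩
  by_cases hnb : ∃ c ∈ Sᶜ, G.Adj i c
  · obtain ⟨c, hc, hic⟩ := hnb
    let f := SimpleGraph.ConnectedComponent.map (G.induceHomOfLE hsub).toHom
    have hf : Function.Surjective f := by
      intro C
      induction C using SimpleGraph.ConnectedComponent.ind with
      | h w =>
      by_cases hw : (w : V) = i
      · refine ⟨(G.induce Sᶜ).connectedComponentMk ⟨c, hc⟩, ?_⟩
        refine SimpleGraph.ConnectedComponent.sound (SimpleGraph.Adj.reachable ?_)
        change G.Adj c w
        rw [hw]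
        exact hic.symm
      · exact ⟨(G.induce Sᶜ).connectedComponentMk ⟨w, hmem w hw⟩, rfl⟩
    have hinj := (hf.bijective_of_nat_card_le hle).1
    exact SimpleGraph.ConnectedComponent.exact (hinj (SimpleGraph.ConnectedComponent.sound hr))
  · push Not at hnb
    have key : ∀ w, (G.induce (S \ {i})ᶜ).Reachable ⟨a, fun h => ha h.1⟩ w →
        ∃ hw : (w : V) ∈ Sᶜ, (G.induce Sᶜ).Reachable ⟨a, ha⟩ ⟨w, hw⟩ := by
      intro w hw
      rw [SimpleGraph.reachable_iff_reflTransGen] at hw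
      induction hw with
      | refl => exact ⟨ha, SimpleGraph.Reachable.refl _⟩
      | @tail c d _ hcd ih =>
        obtain ⟨hc, hac⟩ := ih
        have hcd' : G.Adj c d := hcd
        have hd : (d : V) ∈ Sᶜ := hmem d fun h => hnb c hc ((congrArg (G.Adj c) h).mp hcd').symm
        exact ⟨hd, hac.trans (SimpleGraph.Adj.reachable (G := G.induce Sᶜ) hcd')⟩
    exact (key _ hr).2

theorem cutIdeal_diff_singleton_le [Finite V]
    (hle : numComp G S ≤ numComp G (S \ {i})) : cutIdeal K G (S \ {i}) ≤ cutIdeal K G S := by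
  refine Ideal.span_le.2 (Set.union_subset (fun p hp => ?_) ?_)
  · exact varIdeal_le_cutIdeal (varIdeal_mono Set.sdiff_subset (Ideal.subset_span hp))
  rintro _ ⟨a, b, ha, hb, -, hr, rfl⟩
  by_cases h : a ∈ S ∨ b ∈ S
  · exact varIdeal_le_cutIdeal (ebin_mem_varIdeal h)
  · rw [not_or] at h
    exact ebin_mem_cutIdeal h.1 h.2 (reachable_of_numComp_le hle h.1 h.2 hr)

theorem exists_isCutset_cutIdeal_le [Finite V] (K : Type*) [Field K] (G : SimpleGraph V)
    (S : Set V) : ∃ T, IsCutset G T ∧ cutIdeal K G T ≤ cutIdeal K G S := by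
  induction S using WellFoundedLT.induction with
  | ind S ih =>
  by_cases hS : IsCutset G S
  · exact ⟨S, hS, le_rfl⟩
  unfold IsCutset at hS
  push Not at hS
  obtain ⟨i, hi, hle⟩ := hS
  obtain ⟨T, hT, hTS⟩ := ih (S \ {i}) (Set.sdiff_singleton_ssubset.2 hi)
  exact ⟨T, hT, hTS.trans (cutIdeal_diff_singleton_le hle)⟩

end BinomialEdgeIdeal

/-- the primary decomposition `J_G = ⋂_{T ∈ C(G)} P_T(G)`. -/
theorem binomialEdgeIdeal_eq_iInf_cutIdeal (n : ℕ) (K : Type*) [Field K]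
    (G : SimpleGraph (Fin n)) :
    binomialEdgeIdeal K G = ⨅ T ∈ {T : Set (Fin n) | IsCutset G T}, cutIdeal K G T := by

  refine le_antisymm (le_iInf₂ fun _ _ => binomialEdgeIdeal_le_cutIdeal) ?_
  have h := iInf_cutIdeal_le_varIdeal_sup (K := K) ∅ G
  have h₀ : varIdeal K (∅ : Set (Fin n)) = ⊥ := by simp [varIdeal]
  rw [h₀, bot_sup_eq] at h
  refine le_trans (le_iInf₂ fun S _ => ?_) h
  obtain ⟨T, hT, hTS⟩ := exists_isCutset_cutIdeal_le K G S
  exact (iInf₂_le T hT).trans hTS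
end
end

section
/- For every finite simple graph G on vertex set [n], every field K, and every subset T ⊆ [n], the ideal P_T(G) is a prime ideal of S of height n − c(T) + |T|. -/
/-!
Common definitions: binomial edge ideals, cutsets, the prime ideals `P_T(G)`,
block graphs, clique degrees, endblocks, decomposability, and their relative
versions for induced subgraphs (an induced subgraph of `G` is recorded by its
vertex set `W`).
-/

noncomputable section
open MvPolynomial

section Toric

variable {K : Type*} [Field K] {σ τ υ : Type*}

open Classical in
/-- The homomorphism sending the variables in `Z` to zero and every other variable `v` to the
monomial with exponent `w v`. -/
def toricHom (K : Type*) [Field K] {σ τ : Type*} (Z : Set σ) (w : σ → τ →₀ ℕ) :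
    MvPolynomial σ K →ₐ[K] MvPolynomial τ K :=
  aeval fun v => if v ∈ Z then 0 else monomial (w v) 1

theorem toricHom_X_of_mem {Z : Set σ} (w : σ → τ →₀ ℕ) {v : σ} (hv : v ∈ Z) :
    toricHom K Z w (X v) = 0 := by
  simp [toricHom, hv]

theorem toricHom_X_of_notMem {Z : Set σ} (w : σ → τ →₀ ℕ) {v : σ} (hv : v ∉ Z) :
    toricHom K Z w (X v) = monomial (w v) 1 := by
  simp [toricHom, hv]

theorem toricHom_monomial {Z : Set σ} (w : σ → τ →₀ ℕ) {m : σ →₀ ℕ}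
    (hm : ∀ v ∈ m.support, v ∉ Z) :
    toricHom K Z w (monomial m 1) = monomial (Finsupp.linearCombination ℕ w m) 1 := by
  rw [toricHom, aeval_monomial, map_one, one_mul, Finsupp.linearCombination_apply, Finsupp.sum,
    monomial_sum_one, Finsupp.prod]
  refine Finset.prod_congr rfl fun v hv => ?_
  rw [if_neg (hm v hv), monomial_pow, one_pow]

theorem monomial_mem_of_X_mem {I : Ideal (MvPolynomial σ K)} {v : σ} (hv : X v ∈ I)
    {m : σ →₀ ℕ} (hm : v ∈ m.support) (c : K) : monomial m c ∈ I := by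
  refine I.mem_of_dvd ?_ hv
  exact X_dvd_monomial.2 (Or.inr (Finsupp.mem_support_iff.1 hm))

open Classical in
/-- An ideal containing the variables in `Z` and all differences of monomials of equal weight
contains the kernel of `toricHom K Z w`. -/
theorem ker_toricHom_le {Z : Set σ} {w : σ → τ →₀ ℕ} {I : Ideal (MvPolynomial σ K)}
    (hZ : ∀ v ∈ Z, X v ∈ I)
    (hI : ∀ m m' : σ →₀ ℕ, Finsupp.linearCombination ℕ w m = Finsupp.linearCombination ℕ w m' →
      monomial m (1 : K) - monomial m' 1 ∈ I) :
    RingHom.ker (toricHom K Z w) ≤ I := by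
  let lift : MvPolynomial τ K →ₗ[K] MvPolynomial σ K ⧸ I :=
    (basisMonomials τ K).constr K fun e =>
      if h : ∃ m, Finsupp.linearCombination ℕ w m = e then
        Ideal.Quotient.mk I (monomial h.choose 1) else 0
  have key : lift ∘ₗ (toricHom K Z w).toLinearMap = (Ideal.Quotient.mkₐ K I).toLinearMap := by
    refine (basisMonomials σ K).ext fun m => ?_
    simp only [coe_basisMonomials, LinearMap.comp_apply, AlgHom.toLinearMap_apply,
      Ideal.Quotient.mkₐ_eq_mk]
    by_cases hm : ∀ v ∈ m.support, v ∉ Z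
    · rw [toricHom_monomial w hm]
      have h : ∃ m', Finsupp.linearCombination ℕ w m' = Finsupp.linearCombination ℕ w m :=
        ⟨m, rfl⟩
      have := (basisMonomials τ K).constr_basis K (fun e =>
        if h : ∃ m, Finsupp.linearCombination ℕ w m = e then
          Ideal.Quotient.mk I (monomial h.choose 1) else 0) (Finsupp.linearCombination ℕ w m)
      rw [coe_basisMonomials] at this
      refine this.trans ?_
      rw [dif_pos h]
      exact Ideal.Quotient.eq.2 (hI _ _ h.choose_spec)
    · push Not at hm
      obtain ⟨v, hv, hvZ⟩ := hm
      have h0 : toricHom K Z w (monomial m 1) = 0 :=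
        monomial_mem_of_X_mem (I := RingHom.ker (toricHom K Z w))
          (toricHom_X_of_mem w hvZ) hv 1
      rw [h0, map_zero]
      exact (Ideal.Quotient.eq_zero_iff_mem.2 (monomial_mem_of_X_mem (hZ v hvZ) hv 1)).symm
  intro p hp
  have := LinearMap.congr_fun key p
  simp only [LinearMap.comp_apply, AlgHom.toLinearMap_apply, Ideal.Quotient.mkₐ_eq_mk] at this
  rw [(RingHom.mem_ker).1 hp, map_zero] at this
  exact Ideal.Quotient.eq_zero_iff_mem.1 this.symm

theorem toricHom_comp_kill {Z Z' : Set σ} (h : Z ⊆ Z') (w : σ → τ →₀ ℕ) :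
    (toricHom K Z' w).comp (toricHom K Z fun v => Finsupp.single v 1) = toricHom K Z' w := by
  refine algHom_ext fun v => ?_
  by_cases hv : v ∈ Z
  · simp [toricHom_X_of_mem _ hv, toricHom_X_of_mem _ (h hv)]
  · rw [AlgHom.comp_apply, toricHom_X_of_notMem _ hv, ← X]

theorem rename_comp_toricHom (Z : Set σ) (w : σ → τ →₀ ℕ) (g : τ → υ) :
    (rename g).comp (toricHom K Z w) = toricHom K Z fun v => (w v).mapDomain g := by
  refine algHom_ext fun v => ?_
  by_cases hv : v ∈ Z
  · simp [toricHom_X_of_mem _ hv]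
  · rw [AlgHom.comp_apply, toricHom_X_of_notMem _ hv, toricHom_X_of_notMem _ hv, rename_monomial]

theorem ker_le_ker_of_comp_eq {A B C : Type*} [CommRing A] [CommRing B] [CommRing C]
    [Algebra K A] [Algebra K B] [Algebra K C] {φ : A →ₐ[K] B} {ψ : A →ₐ[K] C}
    (g : B →ₐ[K] C) (h : g.comp φ = ψ) : RingHom.ker φ ≤ RingHom.ker ψ := by
  intro p hp
  rw [RingHom.mem_ker] at hp ⊢
  rw [← h, AlgHom.comp_apply, hp, map_zero]

end Toric

/-- A strictly increasing family of primes indexed by finite sets bounds heights from below. -/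
theorem Ideal.height_add_card_le {R ι : Type*} [CommRing R] [DecidableEq ι]
    (P : Finset ι → Ideal R) (s : Finset ι) (hP : ∀ t, (P t).IsPrime)
    (hlt : ∀ a t, a ∈ s → t ⊆ s → a ∉ t → P t < P (insert a t)) :
    (P ∅).height + s.card ≤ (P s).height := by
  have key : ∀ t : Finset ι, t ⊆ s → (P ∅).height + t.card ≤ (P t).height := by
    intro t
    induction t using Finset.induction_on with
    | empty => simp
    | insert a t ha ih =>
      intro hts
      rw [Finset.insert_subset_iff] at hts
      have := hP t
      have := hP (insert a t)
      rw [Finset.card_insert_of_notMem ha, Nat.cast_add, Nat.cast_one, ← add_assoc]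
      exact (add_le_add_left (ih hts.2) 1).trans
        (Ideal.height_add_one_le_of_lt_of_isPrime (hlt a t hts.1 hts.2 ha))
  exact key s subset_rfl

theorem card_le_height_ker_toricHom {K σ τ : Type*} [Field K] (Z : Finset σ)
    (w : σ → τ →₀ ℕ) : (Z.card : ℕ∞) ≤ (RingHom.ker (toricHom K (Z : Set σ) w)).height := by
  classical
  let P : Finset σ → Ideal (MvPolynomial σ K) := fun s =>
    RingHom.ker (toricHom K (s : Set σ) fun v => Finsupp.single v 1)
  have h := Ideal.height_add_card_le P Z (fun t => RingHom.ker_isPrime _) fun a t _ _ ha => by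
    refine lt_of_le_of_ne (ker_le_ker_of_comp_eq _ (toricHom_comp_kill (by simp) _)) fun h => ?_
    have h1 : X a ∈ P (insert a t) := toricHom_X_of_mem _ (by simp)
    rw [← h] at h1
    have h2 := (RingHom.mem_ker).1 h1
    rw [toricHom_X_of_notMem _ (by simpa using ha)] at h2
    simp at h2
  exact (le_add_self.trans h).trans
    (Ideal.height_mono (ker_le_ker_of_comp_eq _ (toricHom_comp_kill subset_rfl w)))

section EdgeWeight

variable {V : Type*}

/-- Weights parametrizing rank one `2 × m` matrices, with one block for each fibre of `f`: the
variables `x_i` and `y_i` go to `a_{f i} t_i` and `b_{f i} t_i`. -/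
def edgeWeight (f : V → V) (v : V ⊕ V) : (V ⊕ V) ⊕ V →₀ ℕ :=
  Finsupp.single (Sum.inl (Sum.map f f v)) 1 + Finsupp.single (Sum.inr (v.elim id id)) 1

theorem linearCombination_edgeWeight_inr [Fintype V] (f : V → V) (m : V ⊕ V →₀ ℕ) (i : V) :
    Finsupp.linearCombination ℕ (edgeWeight f) m (Sum.inr i) = m (Sum.inl i) + m (Sum.inr i) := by
  classical
  rw [Finsupp.linearCombination_apply, Finsupp.sum_fintype _ _ (by simp)]
  simp [edgeWeight, Finsupp.single_apply]

theorem linearCombination_edgeWeight_inl [Fintype V] [DecidableEq V] (f : V → V)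
    (m : V ⊕ V →₀ ℕ) (c : V) :
    Finsupp.linearCombination ℕ (edgeWeight f) m (Sum.inl (Sum.inl c)) =
      ∑ i with f i = c, m (Sum.inl i) := by
  rw [Finsupp.linearCombination_apply, Finsupp.sum_fintype _ _ (by simp)]
  simp [edgeWeight, Finsupp.single_apply, Finset.sum_filter]

theorem edgeWeight_swap {f : V → V} {i j : V} (h : f i = f j) :
    edgeWeight f (Sum.inl i) + edgeWeight f (Sum.inr j) =
      edgeWeight f (Sum.inl j) + edgeWeight f (Sum.inr i) := by
  simp only [edgeWeight, Sum.map_inl, Sum.map_inr, h, Sum.elim_inl, Sum.elim_inr, id]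
  abel

/-- Monomials of equal weight are congruent modulo the binomials within the fibres of `f`. -/
theorem monomial_sub_mem_of_weight_eq {K : Type*} [Field K] [Fintype V] {f : V → V}
    {I : Ideal (MvPolynomial (V ⊕ V) K)} (hI : ∀ i j, f i = f j → ebin K i j ∈ I)
    (m m' : V ⊕ V →₀ ℕ)
    (h : Finsupp.linearCombination ℕ (edgeWeight f) m =
      Finsupp.linearCombination ℕ (edgeWeight f) m') :
    monomial m (1 : K) - monomial m' 1 ∈ I := by
  classical
  induction hD : ∑ i, (m (Sum.inl i) - m' (Sum.inl i)) using Nat.strong_induction_on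
    generalizing m with
  | _ D ih =>
  have hr : ∀ i, m (Sum.inl i) + m (Sum.inr i) = m' (Sum.inl i) + m' (Sum.inr i) := fun i => by
    rw [← linearCombination_edgeWeight_inr f, h, linearCombination_edgeWeight_inr]
  have hl : ∀ c, ∑ i with f i = c, m (Sum.inl i) = ∑ i with f i = c, m' (Sum.inl i) := fun c => by
    rw [← linearCombination_edgeWeight_inl f, h, linearCombination_edgeWeight_inl]
  by_cases hle : ∀ i, m (Sum.inl i) ≤ m' (Sum.inl i)
  · have heq : ∀ i, m (Sum.inl i) = m' (Sum.inl i) := fun i =>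
      (Finset.sum_eq_sum_iff_of_le fun j _ => hle j).1 (hl (f i)) i (by simp)
    have : m = m' := by
      ext (i | i)
      · exact heq i
      · have := hr i
        have := heq i
        omega
    simp [this]
  · push Not at hle
    obtain ⟨i, hi⟩ := hle
    obtain ⟨j, hji, hj⟩ : ∃ j, f j = f i ∧ m (Sum.inl j) < m' (Sum.inl j) := by
      by_contra! hcon
      have : ∑ k with f k = f i, m' (Sum.inl k) < ∑ k with f k = f i, m (Sum.inl k) :=
        Finset.sum_lt_sum (fun k hk => hcon k (by simpa using hk)) ⟨i, by simp, hi⟩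
      exact this.ne (hl _).symm
    have hij : i ≠ j := by
      rintro rfl
      omega
    have hmj : 0 < m (Sum.inr j) := by
      have := hr j
      omega
    obtain ⟨r, rfl⟩ : ∃ r, m = Finsupp.single (Sum.inl i) 1 + Finsupp.single (Sum.inr j) 1 + r := by
      refine exists_add_of_le ?_
      rintro (k | k)
      · by_cases hk : i = k
        · subst hk
          simp
          omega
        · simp [hk]
      · by_cases hk : j = k
        · subst hk
          simp
          omega
        · simp [hk]
    set m₁ := Finsupp.single (Sum.inl j) 1 + Finsupp.single (Sum.inr i) 1 + r with hm₁
    have hstep : monomial (Finsupp.single (Sum.inl i) 1 + Finsupp.single (Sum.inr j) 1 + r) (1 : K)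
        - monomial m₁ 1 = monomial r 1 * ebin K i j := by
      simp only [hm₁, ebin, X, mul_sub, monomial_mul, one_mul]
      rw [add_comm r, add_comm r]
    have hw : Finsupp.linearCombination ℕ (edgeWeight f) m₁ =
        Finsupp.linearCombination ℕ (edgeWeight f) m' := by
      rw [← h, hm₁]
      simp only [map_add, Finsupp.linearCombination_single, one_smul, edgeWeight_swap hji]
    have hlt : ∑ k, (m₁ (Sum.inl k) - m' (Sum.inl k)) < D := by
      rw [← hD]
      refine Finset.sum_lt_sum (fun k _ => ?_) ⟨i, Finset.mem_univ _, ?_⟩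
      · by_cases hk : j = k
        · subst hk
          simp [hm₁, hij] at hj ⊢
          omega
        · simp [hm₁, hk]
          omega
      · simp [hm₁, hij.symm] at hi ⊢
        omega
    rw [← sub_add_sub_cancel _ (monomial m₁ (1 : K))]
    exact I.add_mem (hstep ▸ I.mul_mem_left _ (hI i j hji.symm)) (ih _ hlt m₁ hw rfl)

variable (K : Type*) [Field K]

/-- The prime ideal of the block structure given by the fibres of `f`, with the variables
indexed by `T` set to zero. -/
def fibreIdeal (T : Set V) (f : V → V) : Ideal (MvPolynomial (V ⊕ V) K) :=
  RingHom.ker (toricHom K {v | v.elim id id ∈ T} (edgeWeight f))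

instance (T : Set V) (f : V → V) : (fibreIdeal K T f).IsPrime := RingHom.ker_isPrime _

theorem X_mem_fibreIdeal {T : Set V} {f : V → V} {v : V ⊕ V} :
    X v ∈ fibreIdeal K T f ↔ v.elim id id ∈ T := by
  refine ⟨fun h => ?_, fun h => toricHom_X_of_mem _ h⟩
  by_contra hv
  have := (RingHom.mem_ker).1 h
  rw [toricHom_X_of_notMem (v := v) _ (by simpa using hv)] at this
  simp at this

theorem ebin_mem_fibreIdeal {T : Set V} {f : V → V} {i j : V} (hij : f i = f j) :
    ebin K i j ∈ fibreIdeal K T f := by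
  by_cases hi : i ∈ T
  · exact Ideal.sub_mem _ (Ideal.mul_mem_right _ _ ((X_mem_fibreIdeal K).2 hi))
      (Ideal.mul_mem_left _ _ ((X_mem_fibreIdeal K).2 hi))
  by_cases hj : j ∈ T
  · exact Ideal.sub_mem _ (Ideal.mul_mem_left _ _ ((X_mem_fibreIdeal K).2 hj))
      (Ideal.mul_mem_right _ _ ((X_mem_fibreIdeal K).2 hj))
  · rw [fibreIdeal, RingHom.mem_ker, ebin, map_sub, map_mul, map_mul,
      toricHom_X_of_notMem _ (by simpa), toricHom_X_of_notMem _ (by simpa),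
      toricHom_X_of_notMem _ (by simpa), toricHom_X_of_notMem _ (by simpa),
      monomial_mul, monomial_mul, edgeWeight_swap hij, sub_self]

theorem ebin_notMem_fibreIdeal {T : Set V} {f : V → V} {i j : V} (hi : i ∉ T) (hj : j ∉ T)
    (hij : f i ≠ f j) : ebin K i j ∉ fibreIdeal K T f := by
  intro h
  rw [fibreIdeal, RingHom.mem_ker, ebin, map_sub, map_mul, map_mul,
    toricHom_X_of_notMem _ (by simpa), toricHom_X_of_notMem _ (by simpa),
    toricHom_X_of_notMem _ (by simpa), toricHom_X_of_notMem _ (by simpa),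
    monomial_mul, monomial_mul, sub_eq_zero, one_mul] at h
  have h' := DFunLike.congr_fun (monomial_left_injective one_ne_zero h) (Sum.inl (Sum.inl (f i)))
  simp [edgeWeight, hij.symm] at h'

theorem fibreIdeal_le [Fintype V] {T : Set V} {f : V → V} {I : Ideal (MvPolynomial (V ⊕ V) K)}
    (hX : ∀ v : V ⊕ V, v.elim id id ∈ T → X v ∈ I)
    (hI : ∀ i j, i ∉ T → j ∉ T → f i = f j → ebin K i j ∈ I) : fibreIdeal K T f ≤ I := by
  refine ker_toricHom_le hX (monomial_sub_mem_of_weight_eq fun i j hij => ?_)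
  by_cases hi : i ∈ T
  · exact I.sub_mem (I.mul_mem_right _ (hX _ hi)) (I.mul_mem_left _ (hX _ hi))
  by_cases hj : j ∈ T
  · exact I.sub_mem (I.mul_mem_left _ (hX _ hj)) (I.mul_mem_right _ (hX _ hj))
  · exact hI i j hi hj hij

theorem fibreIdeal_le_comp (T : Set V) (f g : V → V) :
    fibreIdeal K T f ≤ fibreIdeal K T (g ∘ f) := by
  refine ker_le_ker_of_comp_eq (rename (Sum.map (Sum.map g g) id)) ?_
  rw [rename_comp_toricHom]
  congr 1
  ext1 v
  rw [edgeWeight, Finsupp.mapDomain_add, Finsupp.mapDomain_single, Finsupp.mapDomain_single]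
  cases v <;> rfl

theorem le_height_fibreIdeal [Fintype V] [DecidableEq V] (T : Finset V) {f : V → V}
    (hf : ∀ i, f (f i) = f i) (hT : ∀ i ∈ T, f i = i) (hT' : ∀ i ∉ T, f i ∉ T) :
    ((2 * T.card + (Finset.univ.filter fun i => f i ≠ i).card : ℕ) : ℕ∞) ≤
      (fibreIdeal K (T : Set V) f).height := by
  let F : Finset V → V → V := fun s i => if i ∈ s then f i else i
  set M : Finset V := Finset.univ.filter fun i => f i ≠ i with hM
  have hFM : F M = f := by
    ext1 i
    by_cases hi : f i = i <;> simp [F, hM, hi]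
  have h := Ideal.height_add_card_le (fun s => fibreIdeal K (T : Set V) (F s)) M
    (fun _ => inferInstance) fun a t ha htM hat => by
      have ha' : f a ≠ a := by simpa [hM] using ha
      have haT : a ∉ T := fun h => ha' (hT a h)
      have hfa : f a ∉ t := fun h => by simpa [hM, hf] using htM h
      have hcomp : F (insert a t) = Function.update id a (f a) ∘ F t := by
        ext1 i
        by_cases hia : i = a
        · subst hia
          simp [F, hat]
        · by_cases hit : i ∈ t
          · have : f i ≠ a := fun h => ha' (by rw [← h, hf])
            simp [F, hit, this]
          · simp [F, hit, hia]
      refine lt_of_le_of_ne (hcomp ▸ fibreIdeal_le_comp K _ _ _) fun h => ?_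
      have hmem : ebin K a (f a) ∈ fibreIdeal K (T : Set V) (F (insert a t)) :=
        ebin_mem_fibreIdeal K (by simp [F, hfa, ha'])
      rw [← h] at hmem
      exact ebin_notMem_fibreIdeal K (by simpa using haT) (by simpa using hT' a haT)
        (by simpa [F, hat, hfa] using ha'.symm) hmem
  have h0 := card_le_height_ker_toricHom (K := K) (T.disjSum T) (edgeWeight (F ∅))
  have hset : ((T.disjSum T : Finset (V ⊕ V)) : Set (V ⊕ V)) =
      {v | v.elim id id ∈ (T : Set V)} := by
    ext (v | v) <;> simp
  rw [hset, Finset.card_disjSum, ← two_mul] at h0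
  rw [hFM] at h
  rw [Nat.cast_add]
  exact (add_le_add_left h0 _).trans h

theorem height_fibreIdeal_le [Fintype V] [DecidableEq V] (T : Finset V) {f : V → V}
    (hf : ∀ i, f (f i) = f i) (hT' : ∀ i ∉ T, f i ∉ T) :
    (fibreIdeal K (T : Set V) f).height ≤
      ((2 * T.card + (Finset.univ.filter fun i => f i ≠ i).card : ℕ) : ℕ∞) := by
  classical
  set M : Finset V := Finset.univ.filter fun i => f i ≠ i with hM
  let s : Finset (MvPolynomial (V ⊕ V) K) :=
    (T.disjSum T).image X ∪ M.image fun i => ebin K (f i) i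
  have hs : s.card ≤ 2 * T.card + M.card := by
    refine (Finset.card_union_le _ _).trans (add_le_add ?_ Finset.card_image_le)
    refine Finset.card_image_le.trans ?_
    rw [Finset.card_disjSum, two_mul]
  have hmin : fibreIdeal K (T : Set V) f ∈ (Ideal.span (s : Set _)).minimalPrimes := by
    refine ⟨⟨inferInstance, Ideal.span_le.2 ?_⟩, fun Q hQ hQP => ?_⟩
    · intro p hp
      simp only [s, Finset.coe_union, Finset.coe_image, Set.mem_union, Set.mem_image] at hp
      rcases hp with ⟨v, hv, rfl⟩ | ⟨i, -, rfl⟩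
      · refine (X_mem_fibreIdeal K).2 ?_
        cases v <;> simpa using hv
      · exact ebin_mem_fibreIdeal K (hf i)
    · have hprime := hQ.1
      have hsQ := Ideal.span_le.1 hQ.2
      have hroot : ∀ i, ebin K (f i) i ∈ Q := fun i => by
        by_cases hi : f i = i
        · simp [hi, ebin]
        · exact hsQ (by
            simp only [s, Finset.coe_union, Finset.coe_image]
            exact Or.inr ⟨i, by simpa [hM] using hi, rfl⟩)
      refine fibreIdeal_le K (fun v hv => hsQ ?_) fun i j hi hj hij => ?_
      · simp only [s, Finset.coe_union, Finset.coe_image]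
        refine Or.inl ⟨v, ?_, rfl⟩
        cases v <;> simpa using hv
      · have hx : X (Sum.inl (f i)) ∉ Q := fun h =>
          hT' i hi (by simpa using (X_mem_fibreIdeal K).1 (hQP h))
        refine (hprime.mem_or_mem (x := X (Sum.inl (f i))) ?_).resolve_left hx
        have hj' := hroot j
        rw [← hij] at hj'
        have : X (Sum.inl (f i)) * ebin K i j =
            X (Sum.inl i) * ebin K (f i) j - X (Sum.inl j) * ebin K (f i) i := by
          simp only [ebin]
          ring
        rw [this]
        exact Q.sub_mem (Q.mul_mem_left _ hj') (Q.mul_mem_left _ (hroot i))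
  refine (Ideal.height_le_card_of_mem_minimalPrimes_span_finset hmin).trans ?_
  exact_mod_cast hs

end EdgeWeight

section Components

variable {V : Type*} (G : SimpleGraph V) (T : Set V)

open Classical in
/-- A chosen vertex in the connected component of `i` in the induced subgraph on `Tᶜ`, or `i`
itself if `i ∈ T`. -/
def componentRep (i : V) : V :=
  if h : i ∈ T then i else (((G.induce Tᶜ).connectedComponentMk ⟨i, h⟩).out : ↥Tᶜ)

variable {G T}

theorem componentRep_of_mem {i : V} (hi : i ∈ T) : componentRep G T i = i := dif_pos hi

theorem componentRep_of_notMem {i : V} (hi : i ∉ T) :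
    componentRep G T i = (((G.induce Tᶜ).connectedComponentMk ⟨i, hi⟩).out : ↥Tᶜ) := dif_neg hi

theorem componentRep_notMem {i : V} (hi : i ∉ T) : componentRep G T i ∉ T := by
  rw [componentRep_of_notMem hi]
  exact (((G.induce Tᶜ).connectedComponentMk ⟨i, hi⟩).out : ↥Tᶜ).2

theorem componentRep_eq_iff {i j : V} (hi : i ∉ T) (hj : j ∉ T) :
    componentRep G T i = componentRep G T j ↔ (G.induce Tᶜ).Reachable ⟨i, hi⟩ ⟨j, hj⟩ := by
  rw [componentRep_of_notMem hi, componentRep_of_notMem hj, Subtype.coe_inj,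
    ← SimpleGraph.ConnectedComponent.eq]
  refine ⟨fun h => ?_, fun h => by rw [h]⟩
  exact (Quot.out_eq _).symm.trans ((congrArg _ h).trans (Quot.out_eq _))

theorem connectedComponentMk_componentRep {i : V} (hi : i ∉ T) :
    (G.induce Tᶜ).connectedComponentMk ⟨componentRep G T i, componentRep_notMem hi⟩ =
      (G.induce Tᶜ).connectedComponentMk ⟨i, hi⟩ := by
  refine Eq.trans ?_ (Quot.out_eq ((G.induce Tᶜ).connectedComponentMk ⟨i, hi⟩))
  exact congrArg _ (Subtype.ext (componentRep_of_notMem hi))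

theorem componentRep_idem (i : V) :
    componentRep G T (componentRep G T i) = componentRep G T i := by
  by_cases hi : i ∈ T
  · rw [componentRep_of_mem hi, componentRep_of_mem hi]
  · rw [componentRep_eq_iff (componentRep_notMem hi) hi, ← SimpleGraph.ConnectedComponent.eq]
    exact connectedComponentMk_componentRep hi

theorem ncard_componentRep_fixed :
    {i | i ∉ T ∧ componentRep G T i = i}.ncard = numComp G T := by
  rw [numComp, ← Nat.card_coe_set_eq]
  refine Nat.card_eq_of_bijective
    (fun i => (G.induce Tᶜ).connectedComponentMk ⟨i.1, i.2.1⟩) ⟨fun i j h => ?_, fun c => ?_⟩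
  · have := (componentRep_eq_iff i.2.1 j.2.1).2 (SimpleGraph.ConnectedComponent.eq.1 h)
    rw [i.2.2, j.2.2] at this
    exact Subtype.ext this
  · induction c using SimpleGraph.ConnectedComponent.ind with
    | _ v => exact ⟨⟨componentRep G T v, componentRep_notMem v.2, componentRep_idem _⟩,
        connectedComponentMk_componentRep v.2⟩

theorem cutIdeal_eq_fibreIdeal (K : Type*) [Field K] [Fintype V] :
    cutIdeal K G T = fibreIdeal K T (componentRep G T) := by
  refine le_antisymm (Ideal.span_le.2 ?_) (fibreIdeal_le K (fun v hv => ?_) fun i j hi hj hij => ?_)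
  · rintro p (⟨i, hi, rfl | rfl⟩ | ⟨i, j, hi, hj, -, hij, rfl⟩)
    · exact (X_mem_fibreIdeal K).2 hi
    · exact (X_mem_fibreIdeal K).2 hi
    · exact ebin_mem_fibreIdeal K ((componentRep_eq_iff hi hj).2 hij)
  · refine Ideal.subset_span (Or.inl ⟨v.elim id id, hv, ?_⟩)
    cases v <;> simp
  · by_cases h : i = j
    · simp [h, ebin]
    · exact Ideal.subset_span
        (Or.inr ⟨i, j, hi, hj, h, (componentRep_eq_iff hi hj).1 hij, rfl⟩)

theorem card_componentRep_moved_add [Fintype V] [DecidableEq V] :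
    (Finset.univ.filter fun i => componentRep G T i ≠ i).card + numComp G T + T.ncard =
      Fintype.card V := by
  classical
  have h1 : numComp G T + T.ncard =
      (Finset.univ.filter fun i => componentRep G T i = i).card := by
    rw [← ncard_componentRep_fixed, ← Set.ncard_union_eq, ← Set.ncard_coe_finset]
    · congr 1
      ext i
      by_cases hi : i ∈ T <;> simp [hi, componentRep_of_mem]
    · exact Set.disjoint_left.2 fun i hi => hi.1
  rw [add_assoc, h1, add_comm, Finset.card_filter_add_card_filter_not, Finset.card_univ]

end Components

/-- for every `T ⊆ [n]`, `P_T(G)` is a prime ideal of height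
`n - c(T) + |T|`. -/
theorem cutIdeal_isPrime_height (n : ℕ) (K : Type*) [Field K]
    (G : SimpleGraph (Fin n)) (T : Set (Fin n)) :
    ∃ h : (cutIdeal K G T).IsPrime,
      Order.height (⟨cutIdeal K G T, h⟩ : PrimeSpectrum (MvPolynomial (Fin n ⊕ Fin n) K))
        = ((n - numComp G T + T.ncard : ℕ) : ℕ∞) := by
  classical
  have hP := cutIdeal_eq_fibreIdeal (G := G) (T := T) K
  have hprime : (cutIdeal K G T).IsPrime := hP ▸ inferInstance
  refine ⟨hprime, ?_⟩
  rw [← PrimeSpectrum.height_eq_orderHeight]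
  change (cutIdeal K G T).height = _
  obtain ⟨t, rfl⟩ := T.toFinite.exists_finset_coe
  have hcard := card_componentRep_moved_add (G := G) (T := (t : Set (Fin n)))
  rw [Fintype.card_fin, Set.ncard_coe_finset] at hcard
  have hnum : n - numComp G t + (t : Set (Fin n)).ncard =
      2 * t.card + (Finset.univ.filter fun i => componentRep G (t : Set (Fin n)) i ≠ i).card := by
    rw [Set.ncard_coe_finset]
    omega
  rw [hP, hnum]
  exact le_antisymm
    (height_fibreIdeal_le K t componentRep_idem fun i hi => componentRep_notMem hi)
    (le_height_fibreIdeal K t componentRep_idem (fun i hi => componentRep_of_mem hi)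
      fun i hi => componentRep_notMem hi)
end
end

section
/- For every finite simple graph G on vertex set [n] and every field K, the Krull dimension of S/J_G equals the maximum, over all cutsets T ∈ C(G), of n + c(T) − |T|. -/
/-!
Common definitions: binomial edge ideals, cutsets, the prime ideals `P_T(G)`,
block graphs, clique degrees, endblocks, decomposability, and their relative
versions for induced subgraphs (an induced subgraph of `G` is recorded by its
vertex set `W`).
-/

noncomputable section
open MvPolynomial

open Order in
/-- A finitely generated domain over a field that is algebraic over the subalgebra generated by
a finite family has Krull dimension at most the size of the family. -/
lemma ringKrullDim_le_natCard_of_isAlgebraic_adjoin (K : Type*) {A : Type*} [Field K] [CommRing A]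
    [IsDomain A] [Algebra K A] [Algebra.FiniteType K A] {ι : Type*} [Finite ι] (f : ι → A)
    [Algebra.IsAlgebraic (Algebra.adjoin K (Set.range f)) A] :
    ringKrullDim A ≤ Nat.card ι := by
  obtain ⟨s, g, hg, hint⟩ := exists_integral_inj_algHom_of_fg K A
  have hle : ringKrullDim A ≤ s := by
    algebraize [g.toRingHom]
    have : Algebra.IsIntegral (MvPolynomial (Fin s) K) A := ⟨hint⟩
    calc ringKrullDim A ≤ ringKrullDim (MvPolynomial (Fin s) K) := by
          refine krullDim_le_of_strictMono (PrimeSpectrum.comap (algebraMap _ A)) ?_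
          intro P Q hPQ
          exact Ideal.IsIntegral.comap_lt_comap (R := MvPolynomial (Fin s) K)
            (I := P.asIdeal) (J := Q.asIdeal) hPQ
      _ = s := by simp
  have hs : (s : Cardinal) ≤ Algebra.trdeg K A := by
    have := ((MvPolynomial.algebraicIndependent_X (Fin s) K).map' hg).lift_cardinalMk_le_trdeg
    simpa using this
  have ht : Algebra.trdeg K A ≤ (Nat.card ι : ℕ) := by
    refine (Algebra.IsAlgebraic.trdeg_le_cardinalMk K (Set.range f)).trans ?_
    rw [← Nat.cast_card]
    exact_mod_cast Finite.card_range_le f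
  exact hle.trans (by exact_mod_cast hs.trans ht)

section

open Order

variable {K : Type*} [Field K] {V : Type*}

/-- In a prime containing `J_G`, the binomials of pairs of vertices joined by a path avoiding the
vertices whose variables both lie in the prime are contained as well. -/
lemma ebin_mem_of_reachable {G : SimpleGraph V} {P : Ideal (MvPolynomial (V ⊕ V) K)} [P.IsPrime]
    (hP : binomialEdgeIdeal K G ≤ P) {T : Set V}
    (hT : ∀ i, i ∉ T → X (Sum.inl i) ∉ P ∨ X (Sum.inr i) ∉ P) {i j : ↥Tᶜ}
    (h : (G.induce Tᶜ).Reachable i j) : ebin K (i : V) j ∈ P := by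
  obtain ⟨w⟩ := h
  induction w with
  | nil => simp [ebin]
  | @cons i k j hik w ih =>
    have hik' : ebin K (i : V) k ∈ P := hP (Ideal.subset_span ⟨i, k, by simpa using hik, rfl⟩)
    rcases hT k k.2 with h | h
    · refine (Ideal.IsPrime.mem_or_mem ‹_› (?_ : X (Sum.inl (k : V)) * _ ∈ P)).resolve_left h
      convert P.add_mem (P.mul_mem_left (X (Sum.inl (i : V))) ih)
        (P.mul_mem_left (X (Sum.inl (j : V))) hik') using 1
      simp only [ebin]; ring
    · refine (Ideal.IsPrime.mem_or_mem ‹_› (?_ : X (Sum.inr (k : V)) * _ ∈ P)).resolve_left h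
      convert P.add_mem (P.mul_mem_left (X (Sum.inr (i : V))) ih)
        (P.mul_mem_left (X (Sum.inr (j : V))) hik') using 1
      simp only [ebin]; ring

lemma ringKrullDim_quotient_le_of_isPrime [Finite V] {G : SimpleGraph V}
    {P : Ideal (MvPolynomial (V ⊕ V) K)} [P.IsPrime] (hP : binomialEdgeIdeal K G ≤ P) :
    ∃ T : Set V, ringKrullDim (MvPolynomial (V ⊕ V) K ⧸ P) ≤
      (Tᶜ.ncard + numComp G T : ℕ) := by
  let T : Set V := {i | X (Sum.inl i) ∈ P ∧ X (Sum.inr i) ∈ P}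
  have hT : ∀ i, i ∉ T → X (Sum.inl i) ∉ P ∨ X (Sum.inr i) ∉ P := fun i hi ↦
    not_and_or.mp hi
  let x (i : V) : MvPolynomial (V ⊕ V) K ⧸ P := Ideal.Quotient.mk P (X (Sum.inl i))
  let y (i : V) : MvPolynomial (V ⊕ V) K ⧸ P := Ideal.Quotient.mk P (X (Sum.inr i))
  have hrel {i j : ↥Tᶜ} (h : (G.induce Tᶜ).Reachable i j) : x i * y j = x j * y i := by
    have := Ideal.Quotient.eq_zero_iff_mem.mpr (ebin_mem_of_reachable hP hT h)
    simpa [ebin, sub_eq_zero] using this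
  classical
  let rep (c : (G.induce Tᶜ).ConnectedComponent) : ↥Tᶜ := c.out
  have hrep (i : ↥Tᶜ) : (G.induce Tᶜ).Reachable i
      (rep ((G.induce Tᶜ).connectedComponentMk i)) :=
    (SimpleGraph.ConnectedComponent.exact (Quot.out_eq _)).symm
  let f : ↥Tᶜ ⊕ (G.induce Tᶜ).ConnectedComponent → MvPolynomial (V ⊕ V) K ⧸ P :=
    Sum.elim
      (fun i ↦ if x (rep ((G.induce Tᶜ).connectedComponentMk i)) = 0 then y i else x i)
      (fun c ↦ if x (rep c) = 0 then x (rep c) else y (rep c))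
  have halg : Algebra.IsAlgebraic (Algebra.adjoin K (Set.range f))
      (MvPolynomial (V ⊕ V) K ⧸ P) := by
    let R := Algebra.adjoin K (Set.range f)
    have hf (a) : f a ∈ R := Algebra.subset_adjoin ⟨a, rfl⟩
    have hquot (a b c : MvPolynomial (V ⊕ V) K ⧸ P) (ha : a ∈ R) (ha0 : a ≠ 0) (hb : b ∈ R)
        (h : a * c = b) : IsAlgebraic R c := by
      refine IsAlgebraic.of_mul (R := R) (z := c) (y := algebraMap R _ ⟨a, ha⟩) ?_ ?_ ?_
      · exact mem_nonZeroDivisors_of_ne_zero ha0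
      · exact isAlgebraic_algebraMap _
      · have : algebraMap R _ ⟨a, ha⟩ * c = algebraMap R _ ⟨b, hb⟩ := h
        rw [this]
        exact isAlgebraic_algebraMap _
    have hmem (a) (ha : a ∈ R) : IsAlgebraic R a :=
      isAlgebraic_algebraMap (⟨a, ha⟩ : R)
    have hvar (i : V) : IsAlgebraic R (x i) ∧ IsAlgebraic R (y i) := by
      by_cases hi : i ∈ T
      · have h1 : x i = 0 := Ideal.Quotient.eq_zero_iff_mem.mpr hi.1
        have h2 : y i = 0 := Ideal.Quotient.eq_zero_iff_mem.mpr hi.2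
        rw [h1, h2]
        exact ⟨isAlgebraic_zero, isAlgebraic_zero⟩
      · lift i to ↥Tᶜ using hi
        set c := (G.induce Tᶜ).connectedComponentMk i with hc
        have h1 := hf (.inl i)
        have h2 := hf (.inl (rep c))
        have h3 := hf (.inr c)
        have hcc : (G.induce Tᶜ).connectedComponentMk (rep c) = c := Quot.out_eq _
        have hr := hrel (hrep i)
        simp only [f, Sum.elim_inl, Sum.elim_inr, hcc, ← hc] at h1 h2 h3 hr
        by_cases h0 : x (rep c) = 0
        · have hy0 : y (rep c) ≠ 0 := by
            rcases hT _ (rep c).2 with h | h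
            · exact absurd (Ideal.Quotient.eq_zero_iff_mem.mp h0) h
            · exact fun h' ↦ h (Ideal.Quotient.eq_zero_iff_mem.mp h')
          simp only [h0, if_true] at h1 h2 h3
          refine ⟨hquot _ 0 _ h2 hy0 (zero_mem _) ?_, hmem _ h1⟩
          rw [mul_comm, hr, h0, zero_mul]
        · simp only [h0, if_false] at h1 h2 h3
          exact ⟨hmem _ h1, hquot _ _ _ h2 h0 (mul_mem h1 h3) hr.symm⟩
    refine ⟨fun a ↦ ?_⟩
    obtain ⟨p, rfl⟩ := Ideal.Quotient.mk_surjective a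
    induction p using MvPolynomial.induction_on with
    | C k => exact hmem _ (R.algebraMap_mem k)
    | add p q hp hq => rw [map_add]; exact hp.add hq
    | mul_X p i hp =>
      rw [map_mul]
      rcases i with i | i
      · exact hp.mul (hvar i).1
      · exact hp.mul (hvar i).2
  refine ⟨T, (ringKrullDim_le_natCard_of_isAlgebraic_adjoin K f).trans_eq ?_⟩
  rw [Nat.card_sum, numComp, Nat.card_coe_set_eq]

lemma ringKrullDim_quotient_binomialEdgeIdeal_le [Finite V] (G : SimpleGraph V)
    {d : WithBot ℕ∞} (hd : ∀ T : Set V, ((Tᶜ.ncard + numComp G T : ℕ) : WithBot ℕ∞) ≤ d) :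
    ringKrullDim (MvPolynomial (V ⊕ V) K ⧸ binomialEdgeIdeal K G) ≤ d := by
  rw [ringKrullDim_quotient, krullDim_eq_iSup_coheight]
  refine iSup_le fun ⟨P, hP⟩ ↦ ?_
  have hPG : binomialEdgeIdeal K G ≤ P.asIdeal := hP
  obtain ⟨T, hT⟩ := ringKrullDim_quotient_le_of_isPrime hPG
  refine le_trans ?_ (hT.trans (hd T))
  rw [coheight_eq_krullDim_Ici, ringKrullDim_quotient]
  exact krullDim_le_of_strictMono
    (β := PrimeSpectrum.zeroLocus (P.asIdeal : Set (MvPolynomial (V ⊕ V) K)))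
    (fun Q ↦ ⟨Q.1.1, show P.asIdeal ≤ Q.1.1.asIdeal from Q.2⟩) fun _ _ h ↦ h

/-- The Krull dimension is bounded below by the size of a finite set whose subsets map strictly
monotonically into the prime spectrum. -/
lemma natCard_le_krullDim_of_strictMono {ι α : Type*} [Finite ι] [Preorder α] {F : Set ι → α}
    (hF : StrictMono F) : (Nat.card ι : WithBot ℕ∞) ≤ krullDim α := by
  let e := Finite.equivFin ι
  let l : LTSeries α := LTSeries.mk (Nat.card ι) (fun k ↦ F {i | (e i).castSucc < k}) (by
    rw [Fin.strictMono_iff_lt_succ]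
    intro k
    refine hF ⟨fun i hi ↦ ?_, fun h ↦ ?_⟩
    · exact lt_trans hi (Fin.castSucc_lt_succ)
    · have : e.symm k ∈ {i | (e i).castSucc < k.castSucc} := h (by simp)
      simp at this)
  exact l.length_le_krullDim

/-- The parametrization `x_i ↦ z_i`, `y_i ↦ z_i s_c` (`c` the component of `i ∉ T`) of the variety
of `P_T(G)`, with the parameters `z_i`, `i ∈ σ`, specialized to `1` and the `s_c`, `c ∈ σ`, to
`0`. -/
def cutParam (K : Type*) [Field K] {V : Type*} (G : SimpleGraph V) (T : Set V)
    (σ : Set (↥Tᶜ ⊕ (G.induce Tᶜ).ConnectedComponent)) :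
    MvPolynomial (V ⊕ V) K →ₐ[K]
      MvPolynomial (↥Tᶜ ⊕ (G.induce Tᶜ).ConnectedComponent) K :=
  open Classical in
  let u (i : ↥Tᶜ) : MvPolynomial (↥Tᶜ ⊕ (G.induce Tᶜ).ConnectedComponent) K :=
    if Sum.inl i ∈ σ then 1 else X (Sum.inl i)
  aeval (Sum.elim
    (fun i ↦ if h : i ∈ Tᶜ then u ⟨i, h⟩ else 0)
    (fun i ↦ if h : i ∈ Tᶜ then
      u ⟨i, h⟩ * (if Sum.inr ((G.induce Tᶜ).connectedComponentMk ⟨i, h⟩) ∈ σ then 0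
        else X (Sum.inr ((G.induce Tᶜ).connectedComponentMk ⟨i, h⟩))) else 0))

lemma binomialEdgeIdeal_le_ker_cutParam (G : SimpleGraph V) (T : Set V)
    (σ : Set (↥Tᶜ ⊕ (G.induce Tᶜ).ConnectedComponent)) :
    binomialEdgeIdeal K G ≤ RingHom.ker (cutParam K G T σ) := by
  rw [binomialEdgeIdeal, Ideal.span_le]
  rintro _ ⟨i, j, hij, rfl⟩
  simp only [SetLike.mem_coe, RingHom.mem_ker, ebin, cutParam, map_sub, map_mul, aeval_X,
    Sum.elim_inl, Sum.elim_inr]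
  by_cases hi : i ∈ Tᶜ
  · by_cases hj : j ∈ Tᶜ
    · have : (G.induce Tᶜ).connectedComponentMk ⟨i, hi⟩ =
          (G.induce Tᶜ).connectedComponentMk ⟨j, hj⟩ :=
        SimpleGraph.ConnectedComponent.connectedComponentMk_eq_of_adj (by simpa using hij)
      rw [dif_pos hi, dif_pos hi, dif_pos hj, dif_pos hj, this]
      ring
    · simp only [dif_neg hj]; ring
  · simp only [dif_neg hi]; ring

lemma ker_cutParam_strictMono (G : SimpleGraph V) (T : Set V) :
    StrictMono fun σ ↦ RingHom.ker (cutParam K G T σ) := by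
  classical
  have hmono : Monotone fun σ ↦ RingHom.ker (cutParam K G T σ) := by
    intro σ τ h
    let ρ : MvPolynomial (↥Tᶜ ⊕ (G.induce Tᶜ).ConnectedComponent) K →ₐ[K]
        MvPolynomial (↥Tᶜ ⊕ (G.induce Tᶜ).ConnectedComponent) K :=
      aeval (fun a ↦ if a ∈ τ then Sum.elim (fun _ ↦ 1) (fun _ ↦ 0) a else X a)
    have hρ : cutParam K G T τ = ρ.comp (cutParam K G T σ) := by
      have hu (i : ↥Tᶜ) : ρ (if Sum.inl i ∈ σ then 1 else X (Sum.inl i)) =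
          if Sum.inl i ∈ τ then 1 else X (Sum.inl i) := by
        by_cases hi : Sum.inl i ∈ σ
        · simp [hi, h hi]
        · simp [hi, ρ]
      have hv (c : (G.induce Tᶜ).ConnectedComponent) :
          ρ (if Sum.inr c ∈ σ then 0 else X (Sum.inr c)) =
          if Sum.inr c ∈ τ then 0 else X (Sum.inr c) := by
        by_cases hi : Sum.inr c ∈ σ
        · simp [hi, h hi]
        · simp [hi, ρ]
      refine MvPolynomial.algHom_ext fun a ↦ ?_
      rcases a with i | i <;> by_cases hi : i ∈ Tᶜ <;>
        simp only [AlgHom.comp_apply, cutParam, aeval_X, Sum.elim_inl, Sum.elim_inr, dif_pos hi,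
          dif_neg hi, map_mul, map_zero, hu, hv]
    intro p hp
    have hp' : cutParam K G T σ p = 0 := hp
    change cutParam K G T τ p = 0
    rw [hρ, AlgHom.comp_apply, hp', map_zero]
  intro σ τ h
  obtain ⟨a, haτ, haσ⟩ := Set.exists_of_ssubset h
  refine lt_of_le_not_ge (hmono h.le) fun hle ↦ ?_
  rcases a with i | c
  · have hτ : X (Sum.inl (i : V)) - 1 ∈ RingHom.ker (cutParam K G T τ) := by
      simp only [RingHom.mem_ker, map_sub, map_one, cutParam, aeval_X, Sum.elim_inl, dif_pos i.2,
        Subtype.coe_eta, if_pos haτ, sub_self]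
    have hσ : cutParam K G T σ (X (Sum.inl (i : V)) - 1) = 0 := hle hτ
    simp only [map_sub, map_one, cutParam, aeval_X, Sum.elim_inl, dif_pos i.2, Subtype.coe_eta,
      if_neg haσ] at hσ
    simpa using congrArg (aeval (fun _ ↦ (0 : K))) hσ
  · induction c using SimpleGraph.ConnectedComponent.ind with | _ i
    have hτ : X (Sum.inr (i : V)) ∈ RingHom.ker (cutParam K G T τ) := by
      simp only [RingHom.mem_ker, cutParam, aeval_X, Sum.elim_inr, dif_pos i.2,
        Subtype.coe_eta, if_pos haτ, mul_zero]
    have hσ : cutParam K G T σ (X (Sum.inr (i : V))) = 0 := hle hτ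
    simp only [cutParam, aeval_X, Sum.elim_inr, dif_pos i.2, Subtype.coe_eta,
      if_neg haσ, mul_eq_zero] at hσ
    rcases hσ with hσ | hσ
    · split_ifs at hσ
      · exact one_ne_zero hσ
      · exact X_ne_zero _ hσ
    · exact X_ne_zero _ hσ

lemma le_ringKrullDim_quotient_binomialEdgeIdeal [Finite V] (G : SimpleGraph V) (T : Set V) :
    ((Tᶜ.ncard + numComp G T : ℕ) : WithBot ℕ∞) ≤
      ringKrullDim (MvPolynomial (V ⊕ V) K ⧸ binomialEdgeIdeal K G) := by
  rw [ringKrullDim_quotient, numComp, ← Nat.card_coe_set_eq, ← Nat.card_sum]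
  refine natCard_le_krullDim_of_strictMono (F := fun σ ↦
    ⟨⟨RingHom.ker (cutParam K G T σ), RingHom.ker_isPrime _⟩,
      binomialEdgeIdeal_le_ker_cutParam G T σ⟩) fun σ τ h ↦ ?_
  exact ker_cutParam_strictMono G T h

/-- Every vertex set can be shrunk to a cutset without decreasing `c(T) - |T|`. -/
lemma exists_isCutset_le [Finite V] (G : SimpleGraph V) (T : Set V) :
    ∃ T', IsCutset G T' ∧ Tᶜ.ncard + numComp G T ≤ T'ᶜ.ncard + numComp G T' := by
  induction h : T.ncard using Nat.strong_induction_on generalizing T with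
  | _ m ih =>
    by_cases hT : IsCutset G T
    · exact ⟨T, hT, le_rfl⟩
    · simp only [IsCutset, not_forall, not_lt] at hT
      obtain ⟨i, hi, hle⟩ := hT
      have hlt := Set.ncard_sdiff_singleton_lt_of_mem hi
      obtain ⟨T', hT', h'⟩ := ih _ (h ▸ hlt) (T \ {i}) rfl
      refine ⟨T', hT', le_trans (add_le_add (Set.ncard_le_ncard ?_) hle) h'⟩
      exact Set.compl_subset_compl.mpr Set.sdiff_subset

end

/-- `dim S/J_G = max_{T ∈ C(G)} (n + c(T) - |T|)`. -/
theorem ringKrullDim_quotient_binomialEdgeIdeal (n : ℕ) (K : Type*) [Field K]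
    (G : SimpleGraph (Fin n)) :
    ringKrullDim (MvPolynomial (Fin n ⊕ Fin n) K ⧸ binomialEdgeIdeal K G)
      = ⨆ T ∈ {T : Set (Fin n) | IsCutset G T},
          ((n + numComp G T - T.ncard : ℕ) : WithBot ℕ∞) := by
  have hcard (T : Set (Fin n)) :
      n + numComp G T - T.ncard = Tᶜ.ncard + numComp G T := by
    have := Set.ncard_add_ncard_compl T
    rw [Nat.card_fin] at this
    lia
  simp only [hcard]
  refine le_antisymm (ringKrullDim_quotient_binomialEdgeIdeal_le G fun T ↦ ?_)
    (iSup₂_le fun T _ ↦ le_ringKrullDim_quotient_binomialEdgeIdeal G T)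
  obtain ⟨T', hT', h⟩ := exists_isCutset_le G T
  exact le_iSup₂_of_le T' hT' (by exact_mod_cast h)
end
end

section
/- Let G be a connected block graph on vertex set [n] and K a field. The following are equivalent: (1) G is indecomposable; (2) cdeg(v) ≠ 2 for every vertex v of G; (3) every nonempty cutset T ∈ C(G) satisfies c(T) − |T| ≥ 2, i.e. height P_T(G) < n − 1 = height P_∅(G); equivalently, P_∅(G) is the unique minimal prime of J_G of maximal height. -/
/-!
Common definitions: binomial edge ideals, cutsets, the prime ideals `P_T(G)`,
block graphs, clique degrees, endblocks, decomposability, and their relative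
versions for induced subgraphs (an induced subgraph of `G` is recorded by its
vertex set `W`).
-/

noncomputable section
open MvPolynomial

section BlockGraphs

variable {V : Type*} {G : SimpleGraph V}

theorem SimpleGraph.Reachable.of_closed {P : V → Prop} (hP : ∀ a b, G.Adj a b → P a → P b)
    {a b : V} (h : G.Reachable a b) (ha : P a) : P b := by
  obtain ⟨w⟩ := h
  induction w with
  | nil => exact ha
  | cons hadj _ ih => exact ih (hP _ _ hadj ha)

/-- In a block graph, two neighbours of `v` joined by a walk avoiding `v` are adjacent. -/
theorem IsBlockGraph.adj_of_reachable_induce (hG : IsBlockGraph G) {v a b : V} {S : Set V}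
    (hv : v ∉ S) (ha : a ∈ S) (hb : b ∈ S) (hva : G.Adj v a) (hvb : G.Adj v b) (hab : a ≠ b)
    (h : (G.induce S).Reachable ⟨a, ha⟩ ⟨b, hb⟩) : G.Adj a b := by
  classical
  obtain ⟨p, hp⟩ := h.exists_isPath
  let q : G.Walk a b := p.map (SimpleGraph.Embedding.induce S).toHom
  have hq : q.IsPath := hp.map Subtype.val_injective
  have hvq : v ∉ q.support := by
    intro hmem
    obtain ⟨x, -, rfl⟩ := List.mem_map.1 (SimpleGraph.Walk.support_map _ p ▸ hmem)
    exact hv x.2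
  have hcyc : (SimpleGraph.Walk.cons hva (q.concat hvb.symm)).IsCycle := by
    rw [SimpleGraph.Walk.cons_isCycle_iff]
    refine ⟨hq.concat hvq _, fun hmem => ?_⟩
    rw [SimpleGraph.Walk.edges_concat, List.concat_eq_append, List.mem_append] at hmem
    rcases hmem with hmem | hmem
    · exact hvq (q.fst_mem_support_of_mem_edges hmem)
    · rw [List.mem_singleton, Sym2.eq_iff] at hmem
      rcases hmem with ⟨h1, -⟩ | ⟨-, h2⟩
      · exact hvb.ne h1
      · exact hab h2
  refine hG v _ hcyc a ?_ b ?_ hab <;>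
    simp [SimpleGraph.Walk.support_concat, SimpleGraph.Walk.end_mem_support]

/-- The inclusion-induced map from the components of `G - T` to those of `G - (T ∖ {v})`. -/
def compRestore (G : SimpleGraph V) (T : Set V) (v : V) :
    (G.induce Tᶜ).ConnectedComponent → (G.induce (T \ {v})ᶜ).ConnectedComponent :=
  SimpleGraph.ConnectedComponent.map
    (SimpleGraph.induceHomOfLE G (Set.compl_subset_compl.2 Set.sdiff_subset)).toHom

theorem exists_adj_not_adj_of_numComp_lt [Finite V] {T : Set V} {v : V}
    (h : numComp G (T \ {v}) < numComp G T) :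
    ∃ a b, a ∉ T ∧ b ∉ T ∧ G.Adj v a ∧ G.Adj v b ∧ a ≠ b ∧ ¬ G.Adj a b := by
  classical
  have key : ∀ c₀ : (G.induce Tᶜ).ConnectedComponent, ∃ u, ∃ hu : u ∈ Tᶜ, G.Adj v u ∧
      (G.induce Tᶜ).connectedComponentMk ⟨u, hu⟩ ≠ c₀ := by
    intro c₀
    by_contra! hc
    refine absurd h (not_lt.2 (Nat.card_le_card_of_injective (compRestore G T v) ?_))
    intro x y
    induction x using SimpleGraph.ConnectedComponent.ind with | _ x
    induction y using SimpleGraph.ConnectedComponent.ind with | _ y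
    intro hxy
    have hr := SimpleGraph.ConnectedComponent.exact hxy
    let g : V → (G.induce Tᶜ).ConnectedComponent := fun u =>
      if hu : u ∈ Tᶜ then (G.induce Tᶜ).connectedComponentMk ⟨u, hu⟩ else c₀
    have hg : ∀ u (hu : u ∈ Tᶜ), g u = (G.induce Tᶜ).connectedComponentMk ⟨u, hu⟩ :=
      fun u hu => dif_pos hu
    have hgv : ∀ u, u ∉ Tᶜ → g u = c₀ := fun u hu => dif_neg hu
    have hv : ∀ u ∈ (T \ {v})ᶜ, u ∉ Tᶜ → u = v := by
      intro u hu hu'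
      by_contra hne
      exact hu ⟨not_not.1 hu', hne⟩
    have := hr.of_closed (P := fun u => g u.1 = g x.1) ?_ rfl
    · exact ((hg _ y.2).symm.trans (this.trans (hg _ x.2))).symm
    · rintro ⟨a, ha⟩ ⟨b, hb⟩ (hab : G.Adj a b) hga
      refine Eq.trans ?_ hga
      change g b = g a
      by_cases haT : a ∈ Tᶜ <;> by_cases hbT : b ∈ Tᶜ
      · rw [hg a haT, hg b hbT]
        exact SimpleGraph.ConnectedComponent.sound
          (SimpleGraph.Adj.reachable (G := G.induce Tᶜ) (u := ⟨b, hbT⟩) (v := ⟨a, haT⟩) hab.symm)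
      · obtain rfl := hv b hb hbT
        rw [hg a haT, hgv b hbT, hc a haT hab.symm]
      · obtain rfl := hv a ha haT
        rw [hg b hbT, hgv a haT, hc b hbT hab]
      · rw [hgv a haT, hgv b hbT]
  have hpos : 0 < Nat.card (G.induce Tᶜ).ConnectedComponent := lt_of_le_of_lt (Nat.zero_le _) h
  obtain ⟨⟨c₀⟩, -⟩ := Nat.card_pos_iff.1 hpos
  obtain ⟨a, ha, hva, -⟩ := key c₀
  obtain ⟨b, hb, hvb, hne⟩ := key ((G.induce Tᶜ).connectedComponentMk ⟨a, ha⟩)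
  refine ⟨a, b, ha, hb, hva, hvb, ?_, fun hab => hne ?_⟩
  · rintro rfl
    exact hne rfl
  · exact SimpleGraph.ConnectedComponent.sound
      (SimpleGraph.Adj.reachable (G := G.induce Tᶜ) (u := ⟨b, hb⟩) (v := ⟨a, ha⟩) hab.symm)

theorem IsBlockGraph.numComp_lt [Finite V] (hG : IsBlockGraph G) {T : Set V} {v a b : V}
    (hv : v ∈ T) (ha : a ∉ T) (hb : b ∉ T) (hva : G.Adj v a) (hvb : G.Adj v b) (hne : a ≠ b)
    (hab : ¬ G.Adj a b) : numComp G (T \ {v}) < numComp G T := by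
  have hmem : ∀ u ∉ T, u ∈ (T \ {v})ᶜ := fun u hu h => hu h.1
  have hvm : v ∈ (T \ {v})ᶜ := fun h => h.2 rfl
  have hreach : ∀ u (hu : u ∉ T), G.Adj v u →
      compRestore G T v ((G.induce Tᶜ).connectedComponentMk ⟨u, hu⟩) =
        (G.induce (T \ {v})ᶜ).connectedComponentMk ⟨v, hvm⟩ := fun u hu hvu =>
    SimpleGraph.ConnectedComponent.sound (SimpleGraph.Adj.reachable
      (G := G.induce (T \ {v})ᶜ) (u := ⟨u, hmem u hu⟩) (v := ⟨v, hvm⟩) hvu.symm)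
  have hsurj : Function.Surjective (compRestore G T v) := by
    intro c
    induction c using SimpleGraph.ConnectedComponent.ind with | _ c
    obtain ⟨u, hu⟩ := c
    by_cases huT : u ∈ T
    · obtain rfl : u = v := by
        by_contra hne
        exact hu ⟨huT, hne⟩
      exact ⟨_, hreach a ha hva⟩
    · exact ⟨(G.induce Tᶜ).connectedComponentMk ⟨u, huT⟩, rfl⟩
  refine lt_of_le_of_ne (Nat.card_le_card_of_surjective _ hsurj) fun heq => hab ?_
  have hinj := ((Nat.bijective_iff_surjective_and_card _).2 ⟨hsurj, heq.symm⟩).1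
  exact hG.adj_of_reachable_induce (S := Tᶜ) (fun h => h hv) ha hb hva hvb hne
    (SimpleGraph.ConnectedComponent.exact (hinj ((hreach a ha hva).trans (hreach b hb hvb).symm)))

theorem IsBlockGraph.isCutset_subset [Finite V] (hG : IsBlockGraph G) {S T : Set V}
    (hT : IsCutset G T) (hST : S ⊆ T) : IsCutset G S := by
  intro v hv
  obtain ⟨a, b, ha, hb, hva, hvb, hne, hab⟩ := exists_adj_not_adj_of_numComp_lt (hT v (hST hv))
  exact hG.numComp_lt hv (fun h => ha (hST h)) (fun h => hb (hST h)) hva hvb hne hab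

theorem SimpleGraph.Connected.numComp_empty (hconn : G.Connected) : numComp G ∅ = 1 := by
  have hc : (G.induce (∅ : Set V)ᶜ).Connected := by
    rw [Set.compl_empty]
    exact (SimpleGraph.induceUnivIso G).connected_iff.2 hconn
  have := hc.preconnected.subsingleton_connectedComponent
  have := hc.nonempty
  have : Nonempty (G.induce (∅ : Set V)ᶜ).ConnectedComponent :=
    this.map (G.induce (∅ : Set V)ᶜ).connectedComponentMk
  exact Nat.card_unique

/-- `u` is a vertex of the component `C` of `G - v`. -/
def MemComp {v : V} (C : (G.induce ({v}ᶜ : Set V)).ConnectedComponent) (u : V) : Prop :=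
  ∃ h : u ∈ ({v}ᶜ : Set V), (G.induce ({v}ᶜ : Set V)).connectedComponentMk ⟨u, h⟩ = C

section Components

variable {v : V} {C D : (G.induce ({v}ᶜ : Set V)).ConnectedComponent} {u w : V}

theorem MemComp.ne (h : MemComp C u) : u ≠ v := h.1

theorem MemComp.of_adj (h : MemComp C u) (huw : G.Adj u w) (hw : w ≠ v) : MemComp C w :=
  ⟨hw, Eq.trans (SimpleGraph.ConnectedComponent.sound (SimpleGraph.Adj.reachable
    (G := G.induce ({v}ᶜ : Set V)) (u := ⟨w, hw⟩) (v := ⟨u, h.1⟩) huw.symm)) h.2⟩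

theorem MemComp.unique (hC : MemComp C u) (hD : MemComp D u) : C = D := hC.2.symm.trans hD.2

theorem memComp_mk (hu : u ≠ v) :
    MemComp ((G.induce ({v}ᶜ : Set V)).connectedComponentMk ⟨u, hu⟩) u := ⟨hu, rfl⟩

theorem SimpleGraph.Connected.exists_adj_memComp (hconn : G.Connected)
    (C : (G.induce ({v}ᶜ : Set V)).ConnectedComponent) : ∃ u, G.Adj v u ∧ MemComp C u := by
  by_contra! hno
  induction C using SimpleGraph.ConnectedComponent.ind with | _ x
  refine ((hconn.preconnected x.1 v).of_closed
    (P := MemComp ((G.induce ({v}ᶜ : Set V)).connectedComponentMk x)) (fun a b hab ha => ?_)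
    (memComp_mk x.2)).ne rfl
  refine ha.of_adj hab ?_
  rintro rfl
  exact hno a hab.symm ha

/-- The vertex `v` together with its neighbours in the component `C` of `G - v`. -/
def compClique {v : V} (C : (G.induce ({v}ᶜ : Set V)).ConnectedComponent) : Set V :=
  insert v {u | G.Adj v u ∧ MemComp C u}

theorem IsBlockGraph.isClique_compClique (hG : IsBlockGraph G)
    (C : (G.induce ({v}ᶜ : Set V)).ConnectedComponent) : G.IsClique (compClique C) := by
  rintro a (rfl | ⟨hva, ha⟩) b (rfl | ⟨hvb, hb⟩) hab
  · exact absurd rfl hab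
  · exact hvb
  · exact hva.symm
  · exact hG.adj_of_reachable_induce (S := {v}ᶜ) (fun h => h rfl) ha.1 hb.1 hva hvb hab
      (SimpleGraph.ConnectedComponent.exact (ha.2.trans hb.2.symm))

theorem subset_compClique {s : Set V} (hs : G.IsClique s) (hv : v ∈ s) (hu : u ∈ s)
    (hC : MemComp C u) : s ⊆ compClique C := by
  intro w hw
  by_cases hwv : w = v
  · exact Or.inl hwv
  refine Or.inr ⟨hs hv hw (Ne.symm hwv), ?_⟩
  by_cases huw : u = w
  · exact huw ▸ hC
  · exact hC.of_adj (hs hu hw huw) hwv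

theorem IsBlockGraph.maximal_compClique (hG : IsBlockGraph G) (hconn : G.Connected)
    (C : (G.induce ({v}ᶜ : Set V)).ConnectedComponent) :
    Maximal G.IsClique (compClique C) := by
  obtain ⟨u, hvu, hu⟩ := hconn.exists_adj_memComp C
  exact ⟨hG.isClique_compClique C, fun s hs hle =>
    subset_compClique hs (hle (Or.inl rfl)) (hle (Or.inr ⟨hvu, hu⟩)) hu⟩

end Components

theorem IsBlockGraph.numComp_singleton [Nontrivial V] (hG : IsBlockGraph G)
    (hconn : G.Connected) (v : V) : numComp G {v} = cliqueDeg G v := by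
  unfold numComp cliqueDeg
  rw [← Nat.card_coe_set_eq]
  refine Nat.card_eq_of_bijective
    (fun C => ⟨compClique C, hG.maximal_compClique hconn C, Or.inl rfl⟩) ⟨?_, ?_⟩
  · intro C D hCD
    have hCD' : compClique C = compClique D := congrArg Subtype.val hCD
    obtain ⟨u, hvu, hu⟩ := hconn.exists_adj_memComp C
    have huD : u ∈ compClique D := hCD' ▸ Or.inr ⟨hvu, hu⟩
    rcases huD with rfl | ⟨-, huD⟩
    · exact absurd rfl hu.ne
    · exact hu.unique huD
  · rintro ⟨s, hs, hv⟩
    obtain ⟨u, hu, huv⟩ : ∃ u ∈ s, u ≠ v := by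
      by_contra! hno
      obtain ⟨w, hvw⟩ := hconn.preconnected.exists_adj_of_nontrivial v
      have hle : s ≤ {v, w} := fun x hx => Or.inl (hno x hx)
      have hw := hs.2 (SimpleGraph.isClique_pair.2 fun _ => hvw) hle
        (Or.inr rfl : w ∈ ({v, w} : Set V))
      exact hvw.ne (hno w hw).symm
    refine ⟨(G.induce ({v}ᶜ : Set V)).connectedComponentMk ⟨u, huv⟩, Subtype.ext ?_⟩
    exact hs.eq_of_ge (hG.isClique_compClique _) (subset_compClique hs.1 hv hu (memComp_mk huv))

theorem IsBlockGraph.cliqueDegOn_insert_comp (hG : IsBlockGraph G) {v : V}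
    (C : (G.induce ({v}ᶜ : Set V)).ConnectedComponent) :
    cliqueDegOn G (insert v {u | MemComp C u}) v = 1 := by
  have hsub : ∀ s : Set V, s ⊆ insert v {u | MemComp C u} → G.IsClique s → v ∈ s →
      s ⊆ compClique C := by
    intro s hs hcl hv u hu
    rcases hs hu with rfl | huC
    · exact Or.inl rfl
    · exact Or.inr ⟨hcl hv hu huC.ne.symm, huC⟩
  have hle : compClique C ⊆ insert v {u | MemComp C u} :=
    Set.insert_subset_insert fun u hu => hu.2
  unfold cliqueDegOn
  rw [Set.ncard_eq_one]
  refine ⟨compClique C, Set.eq_singleton_iff_unique_mem.2 ⟨⟨⟨⟨hle, hG.isClique_compClique C⟩,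
    fun s hs h => hsub s hs.1 hs.2 (h (Or.inl rfl))⟩, Or.inl rfl⟩, ?_⟩⟩
  rintro s ⟨hs, hv⟩
  exact hs.eq_of_le ⟨hle, hG.isClique_compClique C⟩ (hsub s hs.1.1 hs.1.2 hv)

theorem IsBlockGraph.decomposableOn_univ_of_numComp_eq_two (hG : IsBlockGraph G)
    (hconn : G.Connected) {v : V} (h : numComp G {v} = 2) : DecomposableOn G Set.univ := by
  obtain ⟨C, D, hne, huniv⟩ := Nat.card_eq_two_iff.1 h
  have hcover : ∀ u, u = v ∨ MemComp C u ∨ MemComp D u := by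
    intro u
    by_cases huv : u = v
    · exact Or.inl huv
    right
    have hmem : (G.induce ({v}ᶜ : Set V)).connectedComponentMk ⟨u, huv⟩ ∈ ({C, D} : Set _) :=
      huniv ▸ Set.mem_univ _
    exact hmem.imp (fun h => ⟨huv, h⟩) (fun h => ⟨huv, h⟩)
  obtain ⟨a, hva, ha⟩ := hconn.exists_adj_memComp C
  obtain ⟨b, hvb, hb⟩ := hconn.exists_adj_memComp D
  refine ⟨insert v {u | MemComp C u}, insert v {u | MemComp D u}, v, ?_, ?_,
    ⟨v, Or.inl rfl, a, Or.inr ha, hva⟩, ⟨v, Or.inl rfl, b, Or.inr hb, hvb⟩, ?_,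
    hG.cliqueDegOn_insert_comp C, hG.cliqueDegOn_insert_comp D⟩
  · refine Set.eq_univ_of_forall fun u => ?_
    rcases hcover u with h | h | h
    · exact Or.inl (Or.inl h)
    · exact Or.inl (Or.inr h)
    · exact Or.inr (Or.inr h)
  · refine Set.eq_singleton_iff_unique_mem.2 ⟨⟨Or.inl rfl, Or.inl rfl⟩, ?_⟩
    rintro u ⟨h1 | h1, h2 | h2⟩
    · exact h1
    · exact h1
    · exact h2
    · exact absurd (MemComp.unique h1 h2) hne
  · intro x y _ _ hxy
    have hstep : ∀ E : (G.induce ({v}ᶜ : Set V)).ConnectedComponent, ∀ p q, G.Adj p q →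
        MemComp E p → p ∈ insert v {u | MemComp E u} ∧ q ∈ insert v {u | MemComp E u} := by
      intro E p q hpq hp
      refine ⟨Or.inr hp, ?_⟩
      by_cases hq : q = v
      · exact Or.inl hq
      · exact Or.inr (hp.of_adj hpq hq)
    rcases hcover x with rfl | hx | hx
    · rcases hcover y with rfl | hy | hy
      · exact absurd hxy (G.loopless.irrefl _)
      · exact Or.inl (hstep C y x hxy.symm hy).symm
      · exact Or.inr (hstep D y x hxy.symm hy).symm
    · exact Or.inl (hstep C x y hxy hx)
    · exact Or.inr (hstep D x y hxy hx)

theorem subset_or_subset_of_isClique {W₁ W₂ s : Set V}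
    (hedge : ∀ a b, G.Adj a b → (a ∈ W₁ ∧ b ∈ W₁) ∨ (a ∈ W₂ ∧ b ∈ W₂))
    (hcover : W₁ ∪ W₂ = Set.univ) (hs : G.IsClique s) : s ⊆ W₁ ∨ s ⊆ W₂ := by
  by_contra! h
  obtain ⟨⟨a, ha, ha1⟩, b, hb, hb2⟩ := And.imp Set.not_subset.1 Set.not_subset.1 h
  have hb1 : b ∈ W₁ := (hcover ▸ Set.mem_univ b : b ∈ W₁ ∪ W₂).resolve_right hb2
  have hab : a ≠ b := by
    rintro rfl
    exact ha1 hb1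
  rcases hedge a b (hs ha hb hab) with h | h
  · exact ha1 h.1
  · exact hb2 h.2

/-- If `G` is covered by `W₁` and `W₂`, which meet in `v` only, then the unique maximal clique
of `W₁` through `v` is a maximal clique of `G` with a vertex different from `v`. -/
theorem SimpleGraph.Connected.exists_maxClique_of_cliqueDegOn_eq_one (hconn : G.Connected)
    {W₁ W₂ : Set V} {v : V} (hcover : W₁ ∪ W₂ = Set.univ) (hinter : W₁ ∩ W₂ = {v})
    (hex : ∃ a ∈ W₁, ∃ b ∈ W₁, G.Adj a b)
    (hedge : ∀ a b, G.Adj a b → (a ∈ W₁ ∧ b ∈ W₁) ∨ (a ∈ W₂ ∧ b ∈ W₂))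
    (hdeg : cliqueDegOn G W₁ v = 1) :
    ∃ C, Maximal G.IsClique C ∧ v ∈ C ∧ C ⊆ W₁ ∧ (∃ u ∈ C, u ≠ v) ∧
      ∀ s, Maximal G.IsClique s → v ∈ s → s ⊆ W₁ → s = C := by
  have hvW : v ∈ W₁ ∩ W₂ := hinter ▸ rfl
  have hout : ∀ u ∈ W₁, u ∈ W₂ → u = v := fun u h1 h2 => by
    have : u ∈ W₁ ∩ W₂ := ⟨h1, h2⟩
    rwa [hinter] at this
  obtain ⟨C, hC⟩ := Set.ncard_eq_one.1 hdeg
  have hCmem : IsMaxCliqueOn G W₁ C ∧ v ∈ C := by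
    have : C ∈ {B : Set V | IsMaxCliqueOn G W₁ B ∧ v ∈ B} := hC ▸ rfl
    exact this
  obtain ⟨⟨⟨hCW, hCcl⟩, hCmax⟩, hvC⟩ := hCmem
  obtain ⟨w, hw, hvw⟩ : ∃ w ∈ W₁, G.Adj v w := by
    obtain ⟨a, ha, hav⟩ : ∃ a ∈ W₁, a ≠ v := by
      obtain ⟨a, ha, b, hb, hab⟩ := hex
      by_cases hav : a = v
      · exact ⟨b, hb, fun hbv => hab.ne (hav.trans hbv.symm)⟩
      · exact ⟨a, ha, hav⟩
    by_contra! hno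
    refine ((hconn.preconnected a v).of_closed (P := fun u => u ∈ W₁ ∧ u ≠ v) ?_ ⟨ha, hav⟩).2 rfl
    rintro x y hxy ⟨hx, hxv⟩
    have hy : y ∈ W₁ := (hedge x y hxy).elim And.right fun h => absurd (hout x hx h.1) hxv
    refine ⟨hy, ?_⟩
    rintro rfl
    exact hno x hx hxy.symm
  have hne : ∃ u ∈ C, u ≠ v := by
    by_contra! hno
    have hle : C ≤ {v, w} := fun x hx => Or.inl (hno x hx)
    have hpair : ({v, w} : Set V) ⊆ W₁ := Set.insert_subset hvW.1 (Set.singleton_subset_iff.2 hw)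
    have hwC := hCmax ⟨hpair, SimpleGraph.isClique_pair.2 fun _ => hvw⟩ hle
      (Or.inr rfl : w ∈ ({v, w} : Set V))
    exact hvw.ne (hno w hwC).symm
  obtain ⟨u, hu, huv⟩ := hne
  refine ⟨C, ⟨hCcl, fun s hs hle => ?_⟩, hvC, hCW, ⟨u, hu, huv⟩, fun s hs hv hsW => ?_⟩
  · rcases subset_or_subset_of_isClique hedge hcover hs with h | h
    · exact hCmax ⟨h, hs⟩ hle
    · exact absurd (hout u (hCW hu) (h (hle hu))) huv
  · have : s ∈ {B : Set V | IsMaxCliqueOn G W₁ B ∧ v ∈ B} :=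
      ⟨⟨⟨hsW, hs.1⟩, fun t ht hle => hs.2 ht.2 hle⟩, hv⟩
    rwa [hC] at this

theorem SimpleGraph.Connected.exists_cliqueDeg_eq_two (hconn : G.Connected)
    (h : DecomposableOn G Set.univ) : ∃ v, cliqueDeg G v = 2 := by
  obtain ⟨W₁, W₂, v, hcover, hinter, hex₁, hex₂, hedge', hdeg₁, hdeg₂⟩ := h
  have hedge := fun a b => hedge' a b trivial trivial
  obtain ⟨C, hC, hvC, hCW, ⟨u, hu, huv⟩, hCu⟩ :=
    hconn.exists_maxClique_of_cliqueDegOn_eq_one hcover hinter hex₁ hedge hdeg₁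
  obtain ⟨D, hD, hvD, hDW, -, hDu⟩ := hconn.exists_maxClique_of_cliqueDegOn_eq_one
    (Set.union_comm _ _ ▸ hcover) (Set.inter_comm _ _ ▸ hinter) hex₂
    (fun a b hab => (hedge a b hab).symm) hdeg₂
  refine ⟨v, Set.ncard_eq_two.2 ⟨C, D, ?_, ?_⟩⟩
  · rintro rfl
    have : u ∈ W₁ ∩ W₂ := ⟨hCW hu, hDW hu⟩
    rw [hinter] at this
    exact huv this
  · ext s
    constructor
    · rintro ⟨hs, hv⟩
      exact (subset_or_subset_of_isClique hedge hcover hs.1).imp (hCu s hs hv) (hDu s hs hv)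
    · rintro (rfl | rfl)
      · exact ⟨hC, hvC⟩
      · exact ⟨hD, hvD⟩

theorem nontrivial_of_cliqueDeg_eq_two {v : V} (h : cliqueDeg G v = 2) : Nontrivial V := by
  by_contra hV
  rw [not_nontrivial_iff_subsingleton] at hV
  obtain ⟨s, t, hne, hst⟩ := Set.ncard_eq_two.1 h
  have hs : s ∈ {s : Set V | Maximal G.IsClique s ∧ v ∈ s} := hst ▸ Or.inl rfl
  have ht : t ∈ {s : Set V | Maximal G.IsClique s ∧ v ∈ s} := hst ▸ Or.inr rfl
  refine hne (Set.ext fun x => ?_)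
  rw [Subsingleton.elim x v]
  exact iff_of_true hs.2 ht.2

theorem IsBlockGraph.decomposableOn_univ_iff_cliqueDeg (hG : IsBlockGraph G)
    (hconn : G.Connected) : DecomposableOn G Set.univ ↔ ∃ v, cliqueDeg G v = 2 := by
  refine ⟨hconn.exists_cliqueDeg_eq_two, fun ⟨v, hv⟩ => ?_⟩
  have := nontrivial_of_cliqueDeg_eq_two hv
  exact hG.decomposableOn_univ_of_numComp_eq_two hconn
    ((hG.numComp_singleton hconn v).trans hv)

theorem IsBlockGraph.ncard_add_two_le_numComp [Finite V] (hG : IsBlockGraph G)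
    (hconn : G.Connected) (h2 : ∀ v, numComp G {v} ≠ 2) {T : Set V} (hT : IsCutset G T)
    (hne : T.Nonempty) : T.ncard + 2 ≤ numComp G T := by
  induction hk : T.ncard generalizing T with
  | zero => exact absurd hk (Set.ncard_ne_zero_of_mem hne.some_mem)
  | succ k ih =>
    obtain ⟨v, hv⟩ := hne
    have hlt := hT v hv
    rcases (T \ {v}).eq_empty_or_nonempty with he | hne'
    · obtain rfl : T = {v} :=
        Set.Subset.antisymm (Set.sdiff_eq_empty.1 he) (Set.singleton_subset_iff.2 hv)
      rw [he, hconn.numComp_empty] at hlt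
      rw [Set.ncard_singleton] at hk
      have := h2 v
      omega
    · have hcard := Set.ncard_sdiff_singleton_add_one hv
      have := ih (hG.isCutset_subset hT Set.sdiff_subset) hne' (by omega)
      omega

theorem SimpleGraph.Connected.isCutset_singleton (hconn : G.Connected) {v : V}
    (h : numComp G {v} = 2) : IsCutset G {v} := by
  rintro _ rfl
  rw [Set.sdiff_self, hconn.numComp_empty, h]
  exact one_lt_two

end BlockGraphs

/-- for a connected block graph `G` on `[n]`, the following are
equivalent: (1) `G` is indecomposable; (2) no vertex has clique degree `2`;
(3) every nonempty cutset `T` satisfies `c(T) - |T| ≥ 2`, i.e. `P_∅(G)` is the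
unique minimal prime of `J_G` of maximal height `n - 1`. -/
theorem indecomposable_tfae (n : ℕ) (K : Type*) [Field K] (G : SimpleGraph (Fin n))
    (hconn : G.Connected) (hblock : IsBlockGraph G) :
    (¬ DecomposableOn G Set.univ ↔ ∀ v : Fin n, cliqueDeg G v ≠ 2) ∧
    (¬ DecomposableOn G Set.univ ↔
      ∀ T : Set (Fin n), IsCutset G T → T.Nonempty → T.ncard + 2 ≤ numComp G T) := by
  refine ⟨?_, ?_, fun h hdec => ?_⟩
  · rw [hblock.decomposableOn_univ_iff_cliqueDeg hconn, not_exists]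
  · intro hdec T hT hne
    exact hblock.ncard_add_two_le_numComp hconn
      (fun v hv => hdec (hblock.decomposableOn_univ_of_numComp_eq_two hconn hv)) hT hne
  · obtain ⟨v, hv⟩ := hconn.exists_cliqueDeg_eq_two hdec
    have := nontrivial_of_cliqueDeg_eq_two hv
    have hc := (hblock.numComp_singleton hconn v).trans hv
    have hle := h {v} (hconn.isCutset_singleton hc) (Set.singleton_nonempty v)
    rw [Set.ncard_singleton, hc] at hle
    omega
end
end

section
/- Let G be a block graph on [n], T ∈ C(G) a cutset with P_T(G) ∈ Minh(G), and v a vertex of G belonging to at least three endblocks of G. Then v ∈ T. -/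
/-!
Common definitions: binomial edge ideals, cutsets, the prime ideals `P_T(G)`,
block graphs, clique degrees, endblocks, decomposability, and their relative
versions for induced subgraphs (an induced subgraph of `G` is recorded by its
vertex set `W`).
-/

noncomputable section
open MvPolynomial

theorem Function.Surjective.natCard_add_natCard_le {α β ι : Type*} [Finite α] {f : α → β}
    (hf : f.Surjective) {g : ι → α} (hg : g.Injective) {b : β} (hb : ∀ i, f (g i) = b) :
    Nat.card β + Nat.card ι ≤ Nat.card α + 1 := by
  have : Finite β := Finite.of_surjective f hf
  have h₁ : (Set.range g).ncard = Nat.card ι := Set.ncard_range_of_injective hg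
  have h₂ : ({b}ᶜ : Set β) ⊆ f '' (Set.range g)ᶜ := by
    intro c hc
    obtain ⟨x, rfl⟩ := hf c
    refine ⟨x, ?_, rfl⟩
    rintro ⟨i, rfl⟩
    exact hc (hb i)
  have h₃ : ({b}ᶜ : Set β).ncard ≤ ((Set.range g)ᶜ).ncard :=
    (Set.ncard_le_ncard h₂ (Set.toFinite _)).trans (Set.ncard_image_le (Set.toFinite _))
  have h₄ := Set.ncard_add_ncard_compl ({b} : Set β)
  have h₅ := Set.ncard_add_ncard_compl (Set.range g)
  rw [Set.ncard_singleton] at h₄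
  omega

section Components

variable {V : Type*} {G : SimpleGraph V} {T : Set V} {a : V}

theorem mem_compl_of_mem_compl_sdiff_singleton {x : V} (hx : x ∈ (T \ {a})ᶜ) (hxa : x ≠ a) :
    x ∈ Tᶜ :=
  fun h => hx ⟨h, hxa⟩

/-- If the neighbours of `a ∈ T` outside `T` are pairwise connected outside `T`, then putting `a`
back does not connect any new pair of vertices. -/
theorem reachable_induce_compl_of_walk (ha : a ∈ T)
    (h : ∀ x y : ↥Tᶜ, G.Adj a x → G.Adj a y → (G.induce Tᶜ).Reachable x y)
    {u w : ↥(T \ {a})ᶜ} (p : (G.induce (T \ {a})ᶜ).Walk u w) (hw : (w : V) ∈ Tᶜ) :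
    (∀ hu : (u : V) ∈ Tᶜ, (G.induce Tᶜ).Reachable ⟨u, hu⟩ ⟨w, hw⟩) ∧
      ((u : V) = a → ∀ z : ↥Tᶜ, G.Adj a z → (G.induce Tᶜ).Reachable z ⟨w, hw⟩) := by
  induction p with
  | nil => exact ⟨fun _ => SimpleGraph.Reachable.refl _,
      fun hua => absurd (hua.symm ▸ ha : _ ∈ T) hw⟩
  | @cons u t w hadj p ih =>
    have hadj' : G.Adj u t := hadj
    obtain ⟨ih₁, ih₂⟩ := ih hw
    constructor
    · intro hu
      by_cases hta : (t : V) = a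
      · exact ih₂ hta ⟨u, hu⟩ (hta.subst (motive := fun b => G.Adj b u) hadj'.symm)
      · have ht := mem_compl_of_mem_compl_sdiff_singleton t.2 hta
        have : (G.induce Tᶜ).Adj ⟨u, hu⟩ ⟨t, ht⟩ := hadj'
        exact this.reachable.trans (ih₁ ht)
    · intro hua z hz
      have hta : (t : V) ≠ a := fun hta => hadj'.ne (hua.trans hta.symm)
      have ht := mem_compl_of_mem_compl_sdiff_singleton t.2 hta
      have hat : G.Adj a t := hua.subst (motive := fun b => G.Adj b t) hadj'
      exact (h z ⟨t, ht⟩ hz hat).trans (ih₁ ht)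

theorem exists_not_reachable_of_numComp_lt [Finite V] (ha : a ∈ T)
    (h : numComp G (T \ {a}) < numComp G T) :
    ∃ x y : ↥Tᶜ, G.Adj a x ∧ G.Adj a y ∧ ¬ (G.induce Tᶜ).Reachable x y := by
  by_contra! hcon
  refine h.not_ge (Nat.card_le_card_of_injective (SimpleGraph.ConnectedComponent.map
    (G.induceHomOfLE (Set.compl_subset_compl.2 (Set.sdiff_subset (s := T) (t := {a})))).toHom) ?_)
  intro C D
  induction C using SimpleGraph.ConnectedComponent.ind with | _ x
  induction D using SimpleGraph.ConnectedComponent.ind with | _ y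
  intro hCD
  obtain ⟨p⟩ := SimpleGraph.ConnectedComponent.exact hCD
  exact SimpleGraph.ConnectedComponent.sound
    ((reachable_induce_compl_of_walk ha hcon p y.2).1 x.2)

/-- Removing a vertex with neighbours in `Nat.card ι` different remaining components creates
at least `Nat.card ι - 1` new components. -/
theorem numComp_sdiff_add_natCard_le [Finite V] {ι : Type*} [Nonempty ι]
    {x : ι → ↥Tᶜ} (hadj : ∀ i, G.Adj a (x i))
    (hsep : Pairwise fun i j => ¬ (G.induce Tᶜ).Reachable (x i) (x j)) :
    numComp G (T \ {a}) + Nat.card ι ≤ numComp G T + 1 := by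
  have ha' : a ∈ (T \ {a})ᶜ := fun h => h.2 rfl
  have hsub : Tᶜ ⊆ (T \ {a})ᶜ := Set.compl_subset_compl.2 Set.sdiff_subset
  have hmk : ∀ i, (G.induce (T \ {a})ᶜ).connectedComponentMk ⟨x i, hsub (x i).2⟩ =
      (G.induce (T \ {a})ᶜ).connectedComponentMk ⟨a, ha'⟩ := fun i =>
    SimpleGraph.ConnectedComponent.sound
      (SimpleGraph.Adj.reachable (G := G.induce (T \ {a})ᶜ) (hadj i).symm)
  refine Function.Surjective.natCard_add_natCard_le
    (f := SimpleGraph.ConnectedComponent.map (G.induceHomOfLE hsub).toHom)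
    (g := fun i => (G.induce Tᶜ).connectedComponentMk (x i)) ?_ ?_ hmk
  · intro C
    induction C using SimpleGraph.ConnectedComponent.ind with | _ y
    by_cases hy : (y : V) = a
    · obtain ⟨i⟩ := ‹Nonempty ι›
      refine ⟨(G.induce Tᶜ).connectedComponentMk (x i), (hmk i).trans ?_⟩
      congr 1
      exact Subtype.ext hy.symm
    · exact ⟨(G.induce Tᶜ).connectedComponentMk
        ⟨y, mem_compl_of_mem_compl_sdiff_singleton y.2 hy⟩, rfl⟩
  · intro i j hij
    by_contra hne
    exact hsep hne (SimpleGraph.ConnectedComponent.exact hij)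

theorem isCutpoint_iff_numComp_lt :
    IsCutpoint G a ↔ numComp G (({a} : Set V) \ {a}) < numComp G {a} := by
  have h : numComp G (({a} : Set V) \ {a}) = Nat.card G.ConnectedComponent := by
    rw [numComp, Set.sdiff_self, Set.compl_empty]
    exact Nat.card_congr (SimpleGraph.induceUnivIso G).connectedComponentEquiv
  rw [h]
  rfl

end Components

section MaximumExcess

variable {V : Type*} [Finite V] {G : SimpleGraph V}

/-- A set maximizing `c(U) - |U|` among all vertex sets is a cutset. -/
theorem exists_isCutset_forall_numComp_add_ncard_le (G : SimpleGraph V) :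
    ∃ U, IsCutset G U ∧ ∀ T', numComp G T' + U.ncard ≤ numComp G U + T'.ncard := by
  obtain ⟨U, hU⟩ := Finite.exists_max fun U : Set V => (numComp G U : ℤ) - U.ncard
  refine ⟨U, fun i hi => ?_, fun T' => ?_⟩
  · have h₁ := hU (U \ {i})
    have h₂ := Set.ncard_sdiff_singleton_add_one hi (Set.toFinite U)
    omega
  · have := hU T'
    omega

theorem InMinh.numComp_add_ncard_le {T : Set V} (hT : InMinh G T) (T' : Set V) :
    numComp G T' + T.ncard ≤ numComp G T + T'.ncard := by
  obtain ⟨U, hU, hmax⟩ := exists_isCutset_forall_numComp_add_ncard_le G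
  have h₁ := hT.2 U hU
  have h₂ := hmax T'
  omega

end MaximumExcess

namespace IsBlockGraph

variable {V : Type*} {G : SimpleGraph V}

theorem adj_of_reachable (hG : IsBlockGraph G) {T : Set V} {a : V} (ha : a ∈ T) {x y : ↥Tᶜ}
    (hx : G.Adj a x) (hy : G.Adj a y) (hxy : (x : V) ≠ y) (h : (G.induce Tᶜ).Reachable x y) :
    G.Adj x y := by
  obtain ⟨p, hp⟩ := h.exists_isPath
  let q : G.Walk x y := p.map (SimpleGraph.Embedding.induce Tᶜ).toHom
  have hq : q.IsPath :=
    hp.map Subtype.val_injective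
  have haq : a ∉ q.support := by
    intro h
    rw [show q.support = _ from SimpleGraph.Walk.support_map .., List.mem_map] at h
    obtain ⟨z, -, rfl⟩ := h
    exact z.2 ha
  have hcyc : (SimpleGraph.Walk.cons hx (q.concat hy.symm)).IsCycle := by
    rw [SimpleGraph.Walk.cons_isCycle_iff]
    refine ⟨hq.concat haq _, ?_⟩
    rw [SimpleGraph.Walk.edges_concat, List.concat_eq_append, List.mem_append,
      List.mem_singleton]
    rintro (h | h)
    · exact haq (q.fst_mem_support_of_mem_edges h)
    · rw [Sym2.eq_swap, Sym2.eq_iff] at h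
      rcases h with ⟨h, -⟩ | ⟨h, h'⟩
      · exact hxy h
      · exact hy.ne h'
  refine hG a _ hcyc x ?_ y ?_ hxy <;> simp [SimpleGraph.Walk.support_concat]

theorem mem_of_adj_of_adj (hG : IsBlockGraph G) {B : Set V} (hB : Maximal G.IsClique B)
    {u w x : V} (hu : u ∈ B) (hw : w ∈ B) (huw : u ≠ w) (hxu : G.Adj x u) (hxw : G.Adj x w) :
    x ∈ B := by
  refine hB.mem_of_prop_insert (SimpleGraph.isClique_insert.2 ⟨hB.prop, fun b hb hxb => ?_⟩)
  by_cases hbu : b = u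
  · exact hbu ▸ hxu
  by_cases hbw : b = w
  · exact hbw ▸ hxw
  have hx' : x ∈ ({u} : Set V)ᶜ := hxu.ne
  have h₁ : (G.induce {u}ᶜ).Adj ⟨x, hx'⟩ ⟨w, huw.symm⟩ := hxw
  have h₂ : (G.induce {u}ᶜ).Adj ⟨w, huw.symm⟩ ⟨b, hbu⟩ := hB.prop hw hb (Ne.symm hbw)
  exact hG.adj_of_reachable (T := {u}) rfl (x := ⟨x, hx'⟩) (y := ⟨b, hbu⟩) hxu.symm
    (hB.prop hu hb (Ne.symm hbu)) hxb (h₁.reachable.trans h₂.reachable)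

theorem ne_and_not_adj_of_ne (hG : IsBlockGraph G) {B₁ B₂ : Set V}
    (hB₁ : Maximal G.IsClique B₁) (hB₂ : Maximal G.IsClique B₂) (hne : B₁ ≠ B₂)
    {v b₁ b₂ : V} (hv₁ : v ∈ B₁) (hv₂ : v ∈ B₂) (hb₁ : b₁ ∈ B₁) (hb₂ : b₂ ∈ B₂)
    (h₁ : b₁ ≠ v) (h₂ : b₂ ≠ v) : b₁ ≠ b₂ ∧ ¬ G.Adj b₁ b₂ := by
  have key : b₂ ∉ B₁ := by
    intro hmem
    refine hne (hB₂.eq_of_subset hB₁.prop fun c hc => ?_).symm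
    by_cases hcv : c = v
    · exact hcv ▸ hv₁
    by_cases hcb : c = b₂
    · exact hcb ▸ hmem
    exact hG.mem_of_adj_of_adj hB₁ hv₁ hmem h₂.symm (hB₂.prop hc hv₂ hcv) (hB₂.prop hc hb₂ hcb)
  refine ⟨fun h => key (h ▸ hb₁), fun h => key ?_⟩
  exact hG.mem_of_adj_of_adj hB₁ hv₁ hb₁ h₁.symm (hB₂.prop hb₂ hv₂ h₂) h.symm

theorem isCutpoint_of_mem_isCutset [Finite V] (hG : IsBlockGraph G) {T : Set V}
    (hT : IsCutset G T) {a : V} (ha : a ∈ T) : IsCutpoint G a := by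
  obtain ⟨x, y, hx, hy, hxy⟩ := exists_not_reachable_of_numComp_lt ha (hT a ha)
  have hne : (x : V) ≠ y := fun h => hxy (Subtype.ext h ▸ SimpleGraph.Reachable.refl _)
  have hadj : ¬ G.Adj x y := fun h =>
    hxy (SimpleGraph.Adj.reachable (G := G.induce Tᶜ) h)
  rw [isCutpoint_iff_numComp_lt]
  have hsep : ¬ (G.induce {a}ᶜ).Reachable ⟨x, hx.ne'⟩ ⟨y, hy.ne'⟩ := fun h =>
    hadj (hG.adj_of_reachable (T := {a}) rfl hx hy hne h)
  have := numComp_sdiff_add_natCard_le (G := G) (T := {a}) (a := a) (ι := Bool)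
    (x := fun i => bif i then ⟨x, hx.ne'⟩ else ⟨y, hy.ne'⟩)
    (by rintro (_ | _); exacts [hy, hx])
    (by
      rintro (_ | _) (_ | _) hij
      exacts [absurd rfl hij, fun h => hsep h.symm, hsep, absurd rfl hij])
  rw [Nat.card_eq_fintype_card, Fintype.card_bool] at this
  omega

/-- If `a ∈ T` lies in `Nat.card ι` maximal cliques, each having a vertex outside `T`, then
removing `a` creates at least `Nat.card ι - 1` new components. -/
theorem numComp_sdiff_add_natCard_le [Finite V] (hG : IsBlockGraph G) {ι : Type*} [Nonempty ι]
    {T : Set V} {a : V} (ha : a ∈ T) {B : ι → Set V} (hinj : B.Injective)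
    (hB : ∀ i, Maximal G.IsClique (B i)) (haB : ∀ i, a ∈ B i)
    (hx : ∀ i, ∃ x ∈ B i, x ∉ T) :
    numComp G (T \ {a}) + Nat.card ι ≤ numComp G T + 1 := by
  choose x hxB hxT using hx
  have hxa : ∀ i, x i ≠ a := fun i h => hxT i (h ▸ ha)
  have hadj : ∀ i, G.Adj a (x i) := fun i => (hB i).prop (haB i) (hxB i) (hxa i).symm
  refine _root_.numComp_sdiff_add_natCard_le (x := fun i => ⟨x i, hxT i⟩) hadj ?_
  intro i j hij h
  obtain ⟨hne, hnadj⟩ := hG.ne_and_not_adj_of_ne (hB i) (hB j) (hinj.ne hij) (haB i) (haB j)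
    (hxB i) (hxB j) (hxa i) (hxa j)
  exact hnadj (hG.adj_of_reachable ha (hadj i) (hadj j) hne h)

end IsBlockGraph

/-- if `G` is a block graph, `P_T(G) ∈ Minh(G)` and `v` belongs to
at least three endblocks of `G`, then `v ∈ T`. -/
theorem mem_of_three_endblocks (n : ℕ) (K : Type*) [Field K]
    (G : SimpleGraph (Fin n)) (hblock : IsBlockGraph G)
    (T : Set (Fin n)) (hT : IsCutset G T) (hmin : InMinh G T) (v : Fin n)
    (hv : 3 ≤ {B : Set (Fin n) | IsEndblock G B ∧ v ∈ B}.ncard) :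
    v ∈ T := by
  by_contra hvT
  let ι := {B : Set (Fin n) // IsEndblock G B ∧ v ∈ B}
  have hcard : 3 ≤ Nat.card ι := hv
  have : Nonempty ι := (Nat.card_pos_iff.1 (by omega)).1
  have hB : ∀ i : ι, Maximal G.IsClique i.1 := fun i => i.2.1.1
  have hvB : ∀ i : ι, v ∈ i.1 := fun i => i.2.2
  have hne : ∀ i : ι, ∃ x ∈ i.1, x ≠ v := fun i =>
    Set.exists_ne_of_one_lt_ncard i.2.1.2.1 v
  have hcut : IsCutpoint G v := by
    rw [isCutpoint_iff_numComp_lt]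
    have := hblock.numComp_sdiff_add_natCard_le (ι := ι) (T := {v}) rfl
      Subtype.val_injective hB hvB hne
    omega
  have hx : ∀ i : ι, ∃ x ∈ i.1, x ∉ insert v T := by
    intro i
    obtain ⟨x, hxi, hxv⟩ := hne i
    refine ⟨x, hxi, ?_⟩
    rintro (h | hxT)
    · exact hxv h
    · exact hxv (i.2.1.2.2.unique ⟨hxi, hblock.isCutpoint_of_mem_isCutset hT hxT⟩
        ⟨hvB i, hcut⟩)
  have h₁ := hblock.numComp_sdiff_add_natCard_le (ι := ι) (Set.mem_insert v T)
    Subtype.val_injective hB hvB hx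
  rw [Set.insert_sdiff_self_of_notMem hvT] at h₁
  have h₂ := hmin.numComp_add_ncard_le (insert v T)
  rw [Set.ncard_insert_of_notMem hvT] at h₂
  omega
end
end
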